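/- arXiv:1503.04482 — 4 statements merged into one kernel-verified Lean document; each statement's English description precedes it below -/
import Mathlib

section
/- Let L1 be a real symmetric 5×5 matrix such that the family L(t) := cos(t)·L0 + sin(t)·L1 is isospectral, and suppose L_+^3 = 0 but L_+^2 ≠ 0. Then there exists a real orthogonal 5×5 matrix A such that A·L(t)·A^{−1} = cos(t)·L0 + sin(t)·M for all t ∈ ℝ, where M is one of the following three matrices: M = (1/√6)·[[0,0,0,0,3√2],[0,0,1,0,0],[0,1,0,1,0],[0,0,1,0,0],[3√2,0,0,0,0]], M = (1/√6)·[[0,0,3,0,0],[0,0,0,√2,0],[3,0,0,0,3],[0,√2,0,0,0],[0,0,3,0,0]], or M = (1/√3)·[[0,1,0,2,0],[1,0,0,0,2],[0,0,0,0,0],[2,0,0,0,1],[0,2,0,1,0]]. In these three cases dim E equals 2, 2 and 1, respectively. -/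
open Matrix Kronecker

noncomputable section

/-- `L0 = diag(√3, 1/√3, 0, -1/√3, -√3)`. -/
def L0d : Matrix (Fin 5) (Fin 5) ℝ :=
  Matrix.diagonal ![Real.sqrt 3, 1 / Real.sqrt 3, 0, -(1 / Real.sqrt 3), -Real.sqrt 3]

/-- The family `L(t) = cos(t)·L0 + sin(t)·L1` is isospectral: for every `t` the matrix
`L(t)` has eigenvalues exactly `-√3, -1/√3, 0, 1/√3, √3`, each with multiplicity one,
i.e. its characteristic polynomial is `X·(X² - 3)·(X² - 1/3)`. -/
def Isospectral (L1 : Matrix (Fin 5) (Fin 5) ℝ) : Prop :=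
  ∀ t : ℝ, (Real.cos t • L0d + Real.sin t • L1).charpoly =
    Polynomial.X * (Polynomial.X ^ 2 - Polynomial.C 3) *
      (Polynomial.X ^ 2 - Polynomial.C (1 / 3 : ℝ))

/-- `L₊ = ½(L0 - i·L1)`, viewed as a complex matrix. -/
def LplusF (L1 : Matrix (Fin 5) (Fin 5) ℝ) : Matrix (Fin 5) (Fin 5) ℂ :=
  (1 / 2 : ℂ) • (L0d.map Complex.ofReal - Complex.I • L1.map Complex.ofReal)

/-- `E`: the real subspace of `ℝ⁵` spanned by the kernels `ker L(t)`, `t ∈ ℝ`. -/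
def Espan (L1 : Matrix (Fin 5) (Fin 5) ℝ) : Submodule ℝ (Fin 5 → ℝ) :=
  ⨆ t : ℝ, LinearMap.ker (Real.cos t • L0d + Real.sin t • L1).mulVecLin
/-- The second normal form of `L1`. -/
def M₂ : Matrix (Fin 5) (Fin 5) ℝ :=
  (1 / Real.sqrt 6) •
    !![0, 0, 0, 0, 3 * Real.sqrt 2; 0, 0, 1, 0, 0; 0, 1, 0, 1, 0; 0, 0, 1, 0, 0;
       3 * Real.sqrt 2, 0, 0, 0, 0]

/-- The third normal form of `L1`. -/
def M₃ : Matrix (Fin 5) (Fin 5) ℝ :=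
  (1 / Real.sqrt 6) •
    !![0, 0, 3, 0, 0; 0, 0, 0, Real.sqrt 2, 0; 3, 0, 0, 0, 3; 0, Real.sqrt 2, 0, 0, 0;
       0, 0, 3, 0, 0]

/-- The fourth normal form of `L1`. -/
def M₄ : Matrix (Fin 5) (Fin 5) ℝ :=
  (1 / Real.sqrt 3) •
    !![0, 1, 0, 2, 0; 1, 0, 0, 0, 2; 0, 0, 0, 0, 0; 2, 0, 0, 0, 1; 0, 2, 0, 1, 0]

lemma normalForm_cases {ab ao ac ae bo bc be oc oe ce : ℝ}
    (hab : ab ^ 2 = ce ^ 2) (hao : ao ^ 2 = oe ^ 2) (hac : ac ^ 2 = 4 * ce ^ 2)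
    (hae : ae ^ 2 + 2 * oe ^ 2 + 9 * ce ^ 2 = 9) (hbo : bo ^ 2 = oc ^ 2)
    (hbc : bc ^ 2 + 2 * oc ^ 2 + ce ^ 2 = 1) (hbe : be ^ 2 = 4 * ce ^ 2)
    (qab : 4 * (ao * bo) + 3 * (ac * bc) + ae * be = 0)
    (qac : 3 * (ab * bc) + 2 * (ao * oc) - ae * ce = 0)
    (qao : 2 * (ab * bo) + ac * oc = 0) (qbo : 2 * (ab * ao) - be * oe = 0)
    (qoc : ac * ao = 2 * (oe * ce)) (qae : ab * be = ac * ce)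
    (tb : ab * ao * bo + ab * ac * bc + ab * ae * be + bo * oc * bc + bo * oe * be
      + bc * ce * be = 0)
    (tO : ao * ab * bo + ao * ac * oc + ao * ae * oe + bo * bc * oc + bo * be * oe
      + oc * ce * oe = 0) :
    (ab = 0 ∧ ac = 0 ∧ be = 0 ∧ ce = 0 ∧ ao = 0 ∧ oe = 0 ∧ bo = 0 ∧ oc = 0 ∧
        ae ^ 2 = 9 ∧ bc ^ 2 = 1) ∨
      (ab = 0 ∧ ac = 0 ∧ be = 0 ∧ ce = 0 ∧ ao = 0 ∧ oe = 0 ∧ bc = 0 ∧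
        ae ^ 2 = 9 ∧ bo ^ 2 = 1 / 2 ∧ oc ^ 2 = 1 / 2) ∨
      (ab = 0 ∧ ac = 0 ∧ be = 0 ∧ ce = 0 ∧ bo = 0 ∧ oc = 0 ∧ ae = 0 ∧
        bc ^ 2 = 1 ∧ ao ^ 2 = 9 / 2 ∧ oe ^ 2 = 9 / 2) ∨
      (ao = 0 ∧ oe = 0 ∧ bo = 0 ∧ oc = 0 ∧ ae = 0 ∧ bc = 0 ∧
        ab ^ 2 = 1 ∧ ac ^ 2 = 4 ∧ be ^ 2 = 4 ∧ ab * be = ac * ce) := by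
  have hsq : ∀ {x y : ℝ}, x ^ 2 = y ^ 2 → x = 0 → y = 0 := by
    intro x y h hx
    rw [hx] at h
    exact pow_eq_zero_iff two_ne_zero |>.1 (by linarith)
  by_cases h : ce = 0
  · have h1 : ab = 0 := hsq hab.symm h
    have h2 : ac = 0 := by rw [h] at hac; exact pow_eq_zero_iff two_ne_zero |>.1 (by linarith)
    have h3 : be = 0 := by rw [h] at hbe; exact pow_eq_zero_iff two_ne_zero |>.1 (by linarith)
    subst h h1 h2 h3
    have hq : ao * bo = 0 := by linarith
    by_cases hr : bo = 0
    · have hoc := hsq hbo hr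
      subst hr hoc
      have hu : ao * oe * ae = 0 := by linarith
      by_cases h0 : ao = 0
      · have hoe := hsq hao h0
        subst h0 hoe
        left
        refine ⟨rfl, rfl, rfl, rfl, rfl, rfl, rfl, rfl, by linarith, by linarith⟩
      · have hoe : oe ≠ 0 := fun h' => h0 (hsq hao.symm h')
        have hu : ae = 0 := by simpa [h0, hoe] using hu
        subst hu
        right; right; left
        refine ⟨rfl, rfl, rfl, rfl, rfl, rfl, rfl, by linarith, by linarith, by linarith⟩
    · have h0 : ao = 0 := by simpa [hr] using hq
      have hoe := hsq hao h0
      subst h0 hoe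
      have hoc : oc ≠ 0 := fun h' => hr (hsq hbo.symm h')
      have hw : bc = 0 := by
        have : bo * oc * bc = 0 := by linarith
        simpa [hr, hoc] using this
      subst hw
      right; left
      refine ⟨rfl, rfl, rfl, rfl, rfl, rfl, rfl, by linarith, by linarith, by linarith⟩
  · have hp : ab ≠ 0 := fun h' => h (hsq hab h')
    have hac0 : ac ≠ 0 := by
      rintro rfl; exact h (pow_eq_zero_iff two_ne_zero |>.1 (by linarith))
    have hbe0 : be ≠ 0 := by
      rintro rfl; exact h (pow_eq_zero_iff two_ne_zero |>.1 (by linarith))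
    have k1 : 4 * (ao * bo) + ae * be = 0 := by
      refine (mul_eq_zero.1 (?_ : ab * (4 * (ao * bo) + ae * be) = 0)).resolve_left hp
      linear_combination ab / 2 * qab - ac / 2 * qac + ao * qao + ae / 2 * qae
    have hw : bc = 0 := by
      have : ac * bc = 0 := by linarith
      simpa [hac0] using this
    subst hw
    have hu : ae = 0 := by
      have k2 : ao * ae * oe = 0 := by
        linear_combination tO - 3 / 2 * (ao * qao) + bo * qbo + oc * qoc / 2
      by_contra hu
      have h0 : ao = 0 := by
        by_contra h0
        have hoe : oe ≠ 0 := fun h' => h0 (hsq hao.symm h')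
        simp [h0, hoe, hu] at k2
      simp [h0, hu, hbe0] at k1
    subst hu
    have k3 : ao ^ 2 * bo ^ 2 = 0 := by
      have : ao * bo = 0 := by linarith
      rw [← mul_pow, this]; norm_num
    have h0 : oe ^ 2 = 0 := by
      rcases mul_eq_zero.1 k3 with h' | h' <;> linarith
    have hr : oc ^ 2 = 0 := by linarith
    have h0' : ao = 0 := pow_eq_zero_iff two_ne_zero |>.1 (by linarith)
    have hr' : bo = 0 := pow_eq_zero_iff two_ne_zero |>.1 (by linarith)
    have h0'' := pow_eq_zero_iff two_ne_zero |>.1 h0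
    have hr'' := pow_eq_zero_iff two_ne_zero |>.1 hr
    right; right; right
    exact ⟨h0', h0'', hr', hr'', rfl, rfl, by linarith, by linarith, by linarith, qae⟩

/-- `√3 • L0d`. -/
def D₀ : Matrix (Fin 5) (Fin 5) ℝ := Matrix.diagonal ![3, 1, 0, -1, -3]

lemma L0d_eq : L0d = (Real.sqrt 3)⁻¹ • D₀ := by
  have h : Real.sqrt 3 * Real.sqrt 3 = 3 := Real.mul_self_sqrt (by norm_num)
  have h0 : Real.sqrt 3 ≠ 0 := by positivity
  rw [L0d, D₀, ← Matrix.diagonal_smul]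
  congr 1
  ext i
  fin_cases i <;> simp <;> field_simp <;> linarith

lemma det_of_isospectral {N : Matrix (Fin 5) (Fin 5) ℝ}
    (h : Isospectral ((Real.sqrt 3)⁻¹ • N)) (x s : ℝ) :
    (x • (1 : Matrix (Fin 5) (Fin 5) ℝ) - D₀ - s • N).det =
      x * (x ^ 2 - 9 * (1 + s ^ 2)) * (x ^ 2 - (1 + s ^ 2)) := by
  have h3 : Real.sqrt 3 ^ 2 = 3 := Real.sq_sqrt (by norm_num)
  have h0 : Real.sqrt 3 ≠ 0 := by positivity
  set t := Real.arctan s with ht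
  set c := Real.cos t with hc
  have hc0 : c ≠ 0 := (Real.cos_arctan_pos s).ne'
  have hs : Real.sin t = s * c := by
    have := Real.tan_arctan s
    rw [Real.tan_eq_sin_div_cos] at this
    field_simp at this
    linarith
  have hcs : c ^ 2 * (1 + s ^ 2) = 1 := by
    have := Real.cos_sq_add_sin_sq t
    rw [hs] at this
    linear_combination this
  have key := congrArg (Polynomial.eval (c * (Real.sqrt 3)⁻¹ * x)) (h t)
  rw [Matrix.eval_charpoly, L0d_eq, hs] at key
  have e : Matrix.scalar (Fin 5) (c * (Real.sqrt 3)⁻¹ * x) -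
      (c • (Real.sqrt 3)⁻¹ • D₀ + (s * c) • (Real.sqrt 3)⁻¹ • N) =
      (c * (Real.sqrt 3)⁻¹) • (x • (1 : Matrix (Fin 5) (Fin 5) ℝ) - D₀ - s • N) := by
    rw [Matrix.scalar_apply, ← Matrix.smul_one_eq_diagonal]
    module
  rw [e, Matrix.det_smul] at key
  simp only [Fintype.card_fin, Polynomial.eval_mul, Polynomial.eval_X, Polynomial.eval_sub,
    Polynomial.eval_pow, Polynomial.eval_C] at key
  have hk : (c * (Real.sqrt 3)⁻¹) ≠ 0 := by positivity
  set k := c * (Real.sqrt 3)⁻¹ with hkdef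
  have hk2 : 3 * k ^ 2 * (1 + s ^ 2) = 1 := by
    rw [hkdef, mul_pow, inv_pow, h3]; linarith
  refine mul_left_cancel₀ (pow_ne_zero 5 hk) (key.trans ?_)
  have e1 : (k * x) ^ 2 - 3 = k ^ 2 * (x ^ 2 - 9 * (1 + s ^ 2)) := by
    linear_combination 3 * hk2
  have e2 : (k * x) ^ 2 - 1 / 3 = k ^ 2 * (x ^ 2 - (1 + s ^ 2)) := by
    linear_combination hk2 / 3
  rw [e1, e2]
  ring

lemma LplusF_smul (N : Matrix (Fin 5) (Fin 5) ℝ) :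
    LplusF ((Real.sqrt 3)⁻¹ • N) = ((1 / 2 : ℂ) * ((Real.sqrt 3)⁻¹ : ℝ)) •
      (D₀.map Complex.ofReal - Complex.I • N.map Complex.ofReal) := by
  rw [LplusF, L0d_eq]
  ext i j
  simp
  ring

lemma cube_of_LplusF {N : Matrix (Fin 5) (Fin 5) ℝ}
    (h : LplusF ((Real.sqrt 3)⁻¹ • N) ^ 3 = 0) :
    D₀ * D₀ * D₀ = D₀ * N * N + N * D₀ * N + N * N * D₀ ∧
      N * N * N = D₀ * D₀ * N + D₀ * N * D₀ + N * D₀ * D₀ := by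
  have hc : ((1 / 2 : ℂ) * ((Real.sqrt 3)⁻¹ : ℝ)) ≠ 0 := by
    have : Real.sqrt 3 ≠ 0 := by positivity
    simp [this]
  rw [LplusF_smul, smul_pow] at h
  have h' := (smul_eq_zero.1 h).resolve_left (pow_ne_zero 3 hc)
  have hI : Complex.I * Complex.I = -1 := Complex.I_mul_I
  have key : (D₀.map Complex.ofReal - Complex.I • N.map Complex.ofReal) ^ 3 =
      (D₀ * D₀ * D₀ - (D₀ * N * N + N * D₀ * N + N * N * D₀)).map Complex.ofReal +
      Complex.I • (N * N * N - (D₀ * D₀ * N + D₀ * N * D₀ + N * D₀ * D₀)).map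
        Complex.ofReal := by
    have hm : ∀ A B : Matrix (Fin 5) (Fin 5) ℝ, (A * B).map Complex.ofReal =
        A.map Complex.ofReal * B.map Complex.ofReal := fun A B =>
      Matrix.map_mul (f := Complex.ofRealHom)
    have ha : ∀ A B : Matrix (Fin 5) (Fin 5) ℝ, (A + B).map Complex.ofReal =
        A.map Complex.ofReal + B.map Complex.ofReal := fun A B =>
      Matrix.map_add _ Complex.ofReal_add A B
    have hs : ∀ A B : Matrix (Fin 5) (Fin 5) ℝ, (A - B).map Complex.ofReal =
        A.map Complex.ofReal - B.map Complex.ofReal := fun A B =>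
      Matrix.map_sub _ Complex.ofReal_sub A B
    simp only [hm, ha, hs, pow_succ, pow_zero, one_mul, sub_mul, mul_sub, smul_mul_assoc,
      mul_smul_comm, smul_smul, smul_sub, smul_add, hI, neg_mul, neg_smul, smul_neg,
      one_smul]
    abel
  rw [key] at h'
  have hij : ∀ i j, _ := fun i j => congrFun (congrFun h' i) j
  constructor
  · ext i j
    have := congrArg Complex.re (hij i j)
    simp only [Matrix.add_apply, Matrix.smul_apply, Matrix.map_apply, smul_eq_mul,
      Matrix.zero_apply, Complex.add_re, Complex.ofReal_re, Complex.I_mul_re,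
      Complex.ofReal_im, Complex.zero_re, Matrix.sub_apply] at this ⊢
    linarith
  · ext i j
    have := congrArg Complex.im (hij i j)
    simp only [Matrix.add_apply, Matrix.smul_apply, Matrix.map_apply, smul_eq_mul,
      Matrix.zero_apply, Complex.add_im, Complex.ofReal_im, Complex.I_mul_im,
      Complex.ofReal_re, Complex.zero_im, Matrix.sub_apply] at this ⊢
    linarith

section
variable {ab ao ac ae bo bc be oc oe ce : ℝ}

lemma det_expansion {n0 n1 n2 n3 n4 : ℝ}
    (h : Isospectral ((Real.sqrt 3)⁻¹ • !![n0, ab, ao, ac, ae; ab, n1, bo, bc, be;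
      ao, bo, n2, oc, oe; ac, bc, oc, n3, ce; ae, be, oe, ce, n4])) (x s : ℝ) :
    !![x - 3 - s * n0, -(s * ab), -(s * ao), -(s * ac), -(s * ae);
        -(s * ab), x - 1 - s * n1, -(s * bo), -(s * bc), -(s * be);
        -(s * ao), -(s * bo), x - s * n2, -(s * oc), -(s * oe);
        -(s * ac), -(s * bc), -(s * oc), x + 1 - s * n3, -(s * ce);
        -(s * ae), -(s * be), -(s * oe), -(s * ce), x + 3 - s * n4].det =
      x * (x ^ 2 - 9 * (1 + s ^ 2)) * (x ^ 2 - (1 + s ^ 2)) := by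
  rw [← det_of_isospectral h x s]
  congr 1
  ext i j
  fin_cases i <;> fin_cases j <;> simp [D₀]

set_option maxHeartbeats 4000000 in
lemma diag_eq_zero {n0 n1 n2 n3 n4 : ℝ}
    (h : Isospectral ((Real.sqrt 3)⁻¹ • !![n0, ab, ao, ac, ae; ab, n1, bo, bc, be;
      ao, bo, n2, oc, oe; ac, bc, oc, n3, ce; ae, be, oe, ce, n4])) :
    n0 = 0 ∧ n1 = 0 ∧ n2 = 0 ∧ n3 = 0 ∧ n4 = 0 := by
  have H := det_expansion h
  simp [Matrix.det_succ_row_zero, Fin.sum_univ_succ, Fin.succAbove] at H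
  refine ⟨?_, ?_, ?_, ?_, ?_⟩
  · linear_combination -(45 * (H 3 1 - H 3 (-1)) - 9 * (H 3 2 - H 3 (-2))
      + (H 3 3 - H 3 (-3))) / 60 / 144
  · linear_combination (45 * (H 1 1 - H 1 (-1)) - 9 * (H 1 2 - H 1 (-2))
      + (H 1 3 - H 1 (-3))) / 60 / 16
  · linear_combination -(45 * (H 0 1 - H 0 (-1)) - 9 * (H 0 2 - H 0 (-2))
      + (H 0 3 - H 0 (-3))) / 60 / 9
  · linear_combination (45 * (H (-1) 1 - H (-1) (-1)) - 9 * (H (-1) 2 - H (-1) (-2))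
      + (H (-1) 3 - H (-1) (-3))) / 60 / 16
  · linear_combination -(45 * (H (-3) 1 - H (-3) (-1)) - 9 * (H (-3) 2 - H (-3) (-2))
      + (H (-3) 3 - H (-3) (-3))) / 60 / 144

set_option maxHeartbeats 4000000 in
lemma second_order
    (h : Isospectral ((Real.sqrt 3)⁻¹ • !![0, ab, ao, ac, ae; ab, 0, bo, bc, be;
      ao, bo, 0, oc, oe; ac, bc, oc, 0, ce; ae, be, oe, ce, 0])) :
    ab ^ 2 / 2 + ao ^ 2 / 3 + ac ^ 2 / 4 + ae ^ 2 / 6 = 3 / 2 ∧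
    -ab ^ 2 / 2 + bo ^ 2 + bc ^ 2 / 2 + be ^ 2 / 4 = 1 / 2 ∧
    -ao ^ 2 / 3 - bo ^ 2 + oc ^ 2 + oe ^ 2 / 3 = 0 ∧
    -ac ^ 2 / 4 - bc ^ 2 / 2 - oc ^ 2 + ce ^ 2 / 2 = -1 / 2 := by
  have H := det_expansion h
  simp [Matrix.det_succ_row_zero, Fin.sum_univ_succ, Fin.succAbove] at H
  refine ⟨?_, ?_, ?_, ?_⟩
  · linear_combination -(16 * (H 3 1 + H 3 (-1)) - (H 3 2 + H 3 (-2))) / 24 / 144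
  · linear_combination (16 * (H 1 1 + H 1 (-1)) - (H 1 2 + H 1 (-2))) / 24 / 16
  · linear_combination -(16 * (H 0 1 + H 0 (-1)) - (H 0 2 + H 0 (-2))) / 24 / 9
  · linear_combination (16 * (H (-1) 1 + H (-1) (-1)) - (H (-1) 2 + H (-1) (-2))) / 24 / 16

lemma D₀_eq : D₀ = !![3, 0, 0, 0, 0; 0, 1, 0, 0, 0; 0, 0, 0, 0, 0; 0, 0, 0, -1, 0;
    0, 0, 0, 0, -3] := by
  ext i j
  fin_cases i <;> fin_cases j <;> simp [D₀]

set_option maxHeartbeats 4000000 in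
lemma entries_cases
    (hI : Isospectral ((Real.sqrt 3)⁻¹ • !![0, ab, ao, ac, ae; ab, 0, bo, bc, be;
      ao, bo, 0, oc, oe; ac, bc, oc, 0, ce; ae, be, oe, ce, 0]))
    (h3 : LplusF ((Real.sqrt 3)⁻¹ • !![0, ab, ao, ac, ae; ab, 0, bo, bc, be;
      ao, bo, 0, oc, oe; ac, bc, oc, 0, ce; ae, be, oe, ce, 0]) ^ 3 = 0) :
    (ab = 0 ∧ ac = 0 ∧ be = 0 ∧ ce = 0 ∧ ao = 0 ∧ oe = 0 ∧ bo = 0 ∧ oc = 0 ∧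
        ae ^ 2 = 9 ∧ bc ^ 2 = 1) ∨
      (ab = 0 ∧ ac = 0 ∧ be = 0 ∧ ce = 0 ∧ ao = 0 ∧ oe = 0 ∧ bc = 0 ∧
        ae ^ 2 = 9 ∧ bo ^ 2 = 1 / 2 ∧ oc ^ 2 = 1 / 2) ∨
      (ab = 0 ∧ ac = 0 ∧ be = 0 ∧ ce = 0 ∧ bo = 0 ∧ oc = 0 ∧ ae = 0 ∧
        bc ^ 2 = 1 ∧ ao ^ 2 = 9 / 2 ∧ oe ^ 2 = 9 / 2) ∨
      (ao = 0 ∧ oe = 0 ∧ bo = 0 ∧ oc = 0 ∧ ae = 0 ∧ bc = 0 ∧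
        ab ^ 2 = 1 ∧ ac ^ 2 = 4 ∧ be ^ 2 = 4 ∧ ab * be = ac * ce) := by
  obtain ⟨s0, s1, s2, s3⟩ := second_order hI
  obtain ⟨hR, hJ⟩ := cube_of_LplusF h3
  rw [D₀_eq] at hR hJ
  have R := fun i j => congrFun (congrFun hR i) j
  have J := fun i j => congrFun (congrFun hJ i) j
  have r00 := R 0 0
  have r11 := R 1 1
  have r22 := R 2 2
  have r01 := R 0 1
  have r03 := R 0 3
  have r02 := R 0 2
  have r12 := R 1 2
  have r23 := R 2 3
  have r04 := R 0 4
  have j11 := J 1 1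
  have j22 := J 2 2
  clear hR hJ R J hI h3
  simp [Matrix.mul_apply, Fin.sum_univ_succ] at r00 r11 r22 r01 r03 r02 r12 r23
  simp [Matrix.mul_apply, Fin.sum_univ_succ] at r04 j11 j22
  refine normalForm_cases ?_ ?_ ?_ ?_ ?_ ?_ ?_ ?_ ?_ ?_ ?_ ?_ ?_ ?_ ?_
  all_goals linarith

end

lemma finrank_Espan_conj {L M : Matrix (Fin 5) (Fin 5) ℝ} {ε : Fin 5 → ℝ}
    (hε : ∀ i, ε i * ε i = 1)
    (h : ∀ t : ℝ, Real.cos t • L0d + Real.sin t • L =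
      diagonal ε * (Real.cos t • L0d + Real.sin t • M) * diagonal ε) :
    Module.finrank ℝ (Espan L) = Module.finrank ℝ (Espan M) := by
  have hA : diagonal ε * diagonal ε = (1 : Matrix (Fin 5) (Fin 5) ℝ) := by
    rw [Matrix.diagonal_mul_diagonal, ← Matrix.diagonal_one]
    congr 1
    exact funext hε
  have hinv : ∀ v : Fin 5 → ℝ, diagonal ε *ᵥ (diagonal ε *ᵥ v) = v := fun v => by
    rw [Matrix.mulVec_mulVec, hA, Matrix.one_mulVec]
  let e : (Fin 5 → ℝ) ≃ₗ[ℝ] (Fin 5 → ℝ) :=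
    LinearEquiv.ofInvolutive (diagonal ε).mulVecLin hinv
  have he : ∀ v, e v = diagonal ε *ᵥ v := fun _ => rfl
  have key : Espan L = (Espan M).map (e : (Fin 5 → ℝ) →ₗ[ℝ] (Fin 5 → ℝ)) := by
    rw [Espan, Espan, Submodule.map_iSup]
    congr 1
    ext t v
    rw [h t]
    simp only [LinearMap.mem_ker, Matrix.mulVecLin_apply, Submodule.mem_map,
      LinearEquiv.coe_coe, he, ← Matrix.mulVec_mulVec]
    constructor
    · intro hv
      refine ⟨diagonal ε *ᵥ v, ?_, hinv v⟩
      rw [← hinv ((Real.cos t • L0d + Real.sin t • M) *ᵥ diagonal ε *ᵥ v), hv,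
        Matrix.mulVec_zero]
    · rintro ⟨w, hw, rfl⟩
      rw [hinv, hw, Matrix.mulVec_zero]
  rw [key]
  exact LinearEquiv.finrank_map_eq e _

lemma exists_conj_of_signs {N M : Matrix (Fin 5) (Fin 5) ℝ} {ε : Fin 5 → ℝ}
    (hε : ∀ i, ε i * ε i = 1) (h : ∀ i j, N i j = ε i * M i j * ε j) :
    diagonal ε * (diagonal ε)ᵀ = 1 ∧
      (∀ t : ℝ, diagonal ε * (Real.cos t • L0d + Real.sin t • N) * (diagonal ε)⁻¹ =
        Real.cos t • L0d + Real.sin t • M) ∧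
      Module.finrank ℝ (Espan N) = Module.finrank ℝ (Espan M) := by
  have hA : diagonal ε * diagonal ε = (1 : Matrix (Fin 5) (Fin 5) ℝ) := by
    rw [Matrix.diagonal_mul_diagonal, ← Matrix.diagonal_one]
    congr 1
    exact funext hε
  have hconj : ∀ t : ℝ, Real.cos t • L0d + Real.sin t • N =
      diagonal ε * (Real.cos t • L0d + Real.sin t • M) * diagonal ε := by
    intro t
    ext i j
    rw [Matrix.mul_diagonal, Matrix.diagonal_mul]
    simp only [Matrix.add_apply, Matrix.smul_apply, smul_eq_mul, h]
    by_cases hij : i = j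
    · subst hij
      linear_combination -(Real.cos t * L0d i i) * hε i
    · rw [L0d, Matrix.diagonal_apply_ne _ hij]
      ring
  refine ⟨by rw [Matrix.diagonal_transpose, hA], fun t => ?_, finrank_Espan_conj hε hconj⟩
  rw [Matrix.inv_eq_right_inv hA, hconj t]
  simp only [← mul_assoc, hA, one_mul]
  rw [mul_assoc, hA, mul_one]

lemma sqrt_six : Real.sqrt 6 = Real.sqrt 2 * Real.sqrt 3 := by
  rw [← Real.sqrt_mul (by norm_num)]; norm_num

lemma M₂_eq : M₂ = (Real.sqrt 3)⁻¹ • !![0, 0, 0, 0, 3; 0, 0, Real.sqrt 2 / 2, 0, 0;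
    0, Real.sqrt 2 / 2, 0, Real.sqrt 2 / 2, 0; 0, 0, Real.sqrt 2 / 2, 0, 0;
    3, 0, 0, 0, 0] := by
  have h2 : Real.sqrt 2 * Real.sqrt 2 = 2 := Real.mul_self_sqrt (by norm_num)
  have h3 : Real.sqrt 3 ≠ 0 := by positivity
  have h2' : Real.sqrt 2 ≠ 0 := by positivity
  rw [M₂, sqrt_six]
  ext i j
  fin_cases i <;> fin_cases j <;> simp <;> field_simp <;> linarith

lemma M₃_eq : M₃ = (Real.sqrt 3)⁻¹ • !![0, 0, 3 * (Real.sqrt 2 / 2), 0, 0; 0, 0, 0, 1, 0;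
    3 * (Real.sqrt 2 / 2), 0, 0, 0, 3 * (Real.sqrt 2 / 2); 0, 1, 0, 0, 0;
    0, 0, 3 * (Real.sqrt 2 / 2), 0, 0] := by
  have h2 : Real.sqrt 2 * Real.sqrt 2 = 2 := Real.mul_self_sqrt (by norm_num)
  have h3 : Real.sqrt 3 ≠ 0 := by positivity
  have h2' : Real.sqrt 2 ≠ 0 := by positivity
  rw [M₃, sqrt_six]
  ext i j
  fin_cases i <;> fin_cases j <;> simp <;> field_simp <;> linarith

lemma mem_ker_smul_iff {N : Matrix (Fin 5) (Fin 5) ℝ} {t : ℝ} {v : Fin 5 → ℝ} :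
    v ∈ LinearMap.ker (Real.cos t • L0d + Real.sin t • (Real.sqrt 3)⁻¹ • N).mulVecLin ↔
      (Real.cos t • D₀ + Real.sin t • N) *ᵥ v = 0 := by
  have h3 : (Real.sqrt 3)⁻¹ ≠ 0 := by positivity
  have e : Real.cos t • L0d + Real.sin t • (Real.sqrt 3)⁻¹ • N =
      (Real.sqrt 3)⁻¹ • (Real.cos t • D₀ + Real.sin t • N) := by
    rw [L0d_eq]; module
  rw [LinearMap.mem_ker, Matrix.mulVecLin_apply, e, Matrix.smul_mulVec, smul_eq_zero]
  simp [h3]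

lemma mem_Espan {N : Matrix (Fin 5) (Fin 5) ℝ} (t : ℝ) {v : Fin 5 → ℝ}
    (h : (Real.cos t • D₀ + Real.sin t • N) *ᵥ v = 0) :
    v ∈ Espan ((Real.sqrt 3)⁻¹ • N) :=
  Submodule.mem_iSup_of_mem t (mem_ker_smul_iff.2 h)

lemma Espan_le {N : Matrix (Fin 5) (Fin 5) ℝ} {S : Submodule ℝ (Fin 5 → ℝ)}
    (h : ∀ (t : ℝ) (v : Fin 5 → ℝ), (Real.cos t • D₀ + Real.sin t • N) *ᵥ v = 0 → v ∈ S) :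
    Espan ((Real.sqrt 3)⁻¹ • N) ≤ S :=
  iSup_le fun t _ hv => h t _ (mem_ker_smul_iff.1 hv)

lemma finrank_span_pair_eq_two {v w : Fin 5 → ℝ} (h : LinearIndependent ℝ ![v, w]) :
    Module.finrank ℝ (Submodule.span ℝ {v, w}) = 2 := by
  rw [← Matrix.range_cons_cons_empty v w ![]]
  simpa only [Fintype.card_fin] using finrank_span_eq_card h

lemma finrank_Espan_M₂ : Module.finrank ℝ (Espan M₂) = 2 := by
  have h2 : Real.sqrt 2 ≠ 0 := by positivity
  have key : Espan M₂ = Submodule.span ℝ {![0, 0, 1, 0, 0], ![0, 1, 0, -1, 0]} := by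
    rw [M₂_eq]
    apply le_antisymm
    · refine Espan_le fun t v hv => ?_
      have hq := Real.sin_sq_add_cos_sq t
      have H := fun i => congrFun hv i
      have e0 := H 0
      have e1 := H 1
      have e2 := H 2
      have e3 := H 3
      have e4 := H 4
      simp [D₀_eq, Matrix.mulVec, dotProduct, Fin.sum_univ_succ] at e0 e1 e2 e3 e4
      have a0 : v 0 = 0 := by
        linear_combination Real.cos t / 3 * e0 + Real.sin t / 3 * e4 - v 0 * hq
      have a4 : v 4 = 0 := by
        linear_combination Real.sin t / 3 * e0 - Real.cos t / 3 * e4 - v 4 * hq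
      have e5 : Real.sin t * (v 1 + v 3) = 0 := by
        refine (mul_eq_zero.1 (?_ : Real.sqrt 2 * _ = 0)).resolve_left h2
        linear_combination 2 * e2
      have a3 : v 3 = -v 1 := by
        linear_combination Real.cos t * (e1 - e3) + Real.sin t * e5 - (v 1 + v 3) * hq
      rw [Submodule.mem_span_pair]
      refine ⟨v 2, v 1, ?_⟩
      ext i
      fin_cases i <;> simp [a0, a4, a3]
    · rw [Submodule.span_le]
      rintro v (rfl | rfl)
      · refine mem_Espan 0 ?_
        ext i
        fin_cases i <;> simp [D₀_eq]
      · refine mem_Espan (Real.pi / 2) ?_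
        ext i
        fin_cases i <;> simp
  rw [key]
  refine finrank_span_pair_eq_two (LinearIndependent.pair_iff.2 fun a b h => ?_)
  have h1 := congrFun h 1
  have h2 := congrFun h 2
  simp at h1 h2
  exact ⟨h2, h1⟩

lemma finrank_Espan_M₃ : Module.finrank ℝ (Espan M₃) = 2 := by
  have h2 : Real.sqrt 2 ≠ 0 := by positivity
  have key : Espan M₃ = Submodule.span ℝ {![0, 0, 1, 0, 0], ![1, 0, 0, 0, -1]} := by
    rw [M₃_eq]
    apply le_antisymm
    · refine Espan_le fun t v hv => ?_
      have hq := Real.sin_sq_add_cos_sq t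
      have H := fun i => congrFun hv i
      have e0 := H 0
      have e1 := H 1
      have e2 := H 2
      have e3 := H 3
      have e4 := H 4
      simp [D₀_eq, Matrix.mulVec, dotProduct, Fin.sum_univ_succ] at e0 e1 e2 e3 e4
      have a1 : v 1 = 0 := by
        linear_combination Real.cos t * e1 + Real.sin t * e3 - v 1 * hq
      have a3 : v 3 = 0 := by
        linear_combination Real.sin t * e1 - Real.cos t * e3 - v 3 * hq
      have e5 : Real.sin t * (v 0 + v 4) = 0 := by
        refine (mul_eq_zero.1 (?_ : Real.sqrt 2 * _ = 0)).resolve_left h2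
        linear_combination 2 / 3 * e2
      have a4 : v 4 = -v 0 := by
        linear_combination Real.cos t / 3 * (e0 - e4) + Real.sin t * e5 - (v 0 + v 4) * hq
      rw [Submodule.mem_span_pair]
      refine ⟨v 2, v 0, ?_⟩
      ext i
      fin_cases i <;> simp [a1, a3, a4]
    · rw [Submodule.span_le]
      rintro v (rfl | rfl)
      · refine mem_Espan 0 ?_
        ext i
        fin_cases i <;> simp [D₀_eq]
      · refine mem_Espan (Real.pi / 2) ?_
        ext i
        fin_cases i <;> simp
  rw [key]
  refine finrank_span_pair_eq_two (LinearIndependent.pair_iff.2 fun a b h => ?_)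
  have h1 := congrFun h 0
  have h2 := congrFun h 2
  simp at h1 h2
  exact ⟨h2, h1⟩

lemma finrank_Espan_M₄ : Module.finrank ℝ (Espan M₄) = 1 := by
  have key : Espan M₄ = Submodule.span ℝ {![0, 0, 1, 0, 0]} := by
    rw [M₄, one_div]
    apply le_antisymm
    · refine Espan_le fun t v hv => ?_
      have hq := Real.cos_sq_add_sin_sq t
      have H := fun i => congrFun hv i
      have e0 := H 0
      have e1 := H 1
      have e3 := H 3
      have e4 := H 4
      simp [D₀_eq, Matrix.mulVec, dotProduct, Fin.sum_univ_succ] at e0 e1 e3 e4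
      set c := Real.cos t
      set s := Real.sin t
      have f0 : 5 * v 0 + 4 * (c ^ 2 * v 0 + c * s * v 1 + c * s * v 3 + s ^ 2 * v 4) = 0 := by
        linear_combination 3 * c * e0 + s * e1 + 2 * s * e3 - 5 * v 0 * hq
      have f1 : 5 * v 1 + 4 * (c * s * v 0 - c ^ 2 * v 1 + s ^ 2 * v 3 - c * s * v 4) = 0 := by
        linear_combination s * e0 + c * e1 + 2 * s * e4 - 5 * v 1 * hq
      have f3 : 5 * v 3 + 4 * (c * s * v 0 + s ^ 2 * v 1 - c ^ 2 * v 3 - c * s * v 4) = 0 := by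
        linear_combination 2 * s * e0 - c * e3 + s * e4 - 5 * v 3 * hq
      have f4 : 5 * v 4 + 4 * (s ^ 2 * v 0 - c * s * v 1 - c * s * v 3 + c ^ 2 * v 4) = 0 := by
        linear_combination 2 * s * e1 + s * e3 - 3 * c * e4 - 5 * v 4 * hq
      have a0 : v 0 = 0 := by
        linear_combination (5 * f0 - 4 * (c ^ 2 * f0 + c * s * f1 + c * s * f3 + s ^ 2 * f4)
          + 16 * v 0 * (c ^ 2 + s ^ 2 + 1) * hq) / 9
      have a1 : v 1 = 0 := by
        linear_combination (5 * f1 - 4 * (c * s * f0 - c ^ 2 * f1 + s ^ 2 * f3 - c * s * f4)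
          + 16 * v 1 * (c ^ 2 + s ^ 2 + 1) * hq) / 9
      have a3 : v 3 = 0 := by
        linear_combination (5 * f3 - 4 * (c * s * f0 + s ^ 2 * f1 - c ^ 2 * f3 - c * s * f4)
          + 16 * v 3 * (c ^ 2 + s ^ 2 + 1) * hq) / 9
      have a4 : v 4 = 0 := by
        linear_combination (5 * f4 - 4 * (s ^ 2 * f0 - c * s * f1 - c * s * f3 + c ^ 2 * f4)
          + 16 * v 4 * (c ^ 2 + s ^ 2 + 1) * hq) / 9
      rw [Submodule.mem_span_singleton]
      refine ⟨v 2, ?_⟩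
      ext i
      fin_cases i <;> simp [a0, a1, a3, a4]
    · rw [Submodule.span_le]
      rintro v rfl
      refine mem_Espan 0 ?_
      ext i
      fin_cases i <;> simp [D₀_eq]
  rw [key]
  refine finrank_span_singleton fun h => ?_
  have := congrFun h 2
  simp at this

lemma LplusF_sq_eq_zero {ae bc : ℝ} (hae : ae ^ 2 = 9) (hbc : bc ^ 2 = 1) :
    LplusF ((Real.sqrt 3)⁻¹ • !![0, 0, 0, 0, ae; 0, 0, 0, bc, 0; 0, 0, 0, 0, 0;
      0, bc, 0, 0, 0; ae, 0, 0, 0, 0]) ^ 2 = 0 := by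
  have h1 : (ae : ℂ) ^ 2 = 9 := by exact_mod_cast congrArg Complex.ofReal hae
  have h2 : (bc : ℂ) ^ 2 = 1 := by exact_mod_cast congrArg Complex.ofReal hbc
  have hI := Complex.I_sq
  rw [LplusF_smul, smul_pow, smul_eq_zero]
  right
  rw [pow_two]
  ext i j
  fin_cases i <;> fin_cases j <;> simp [D₀_eq, Matrix.mul_apply, Fin.sum_univ_succ] <;>
    grind

lemma exists_sign {x y : ℝ} (h : x ^ 2 = y ^ 2) : ∃ ε : ℝ, ε * ε = 1 ∧ x = ε * y := by
  rcases sq_eq_sq_iff_eq_or_eq_neg.1 h with h | h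
  · exact ⟨1, by norm_num, by linarith⟩
  · exact ⟨-1, by norm_num, by linarith⟩

lemma eq_of_isSymm {N : Matrix (Fin 5) (Fin 5) ℝ} (h : N.IsSymm) :
    N = !![N 0 0, N 0 1, N 0 2, N 0 3, N 0 4; N 0 1, N 1 1, N 1 2, N 1 3, N 1 4;
      N 0 2, N 1 2, N 2 2, N 2 3, N 2 4; N 0 3, N 1 3, N 2 3, N 3 3, N 3 4;
      N 0 4, N 1 4, N 2 4, N 3 4, N 4 4] := by
  ext i j
  fin_cases i <;> fin_cases j <;> first | rfl | exact h.apply _ _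

/-- if `L(t) = cos(t)·L0 + sin(t)·L1` is isospectral with `L₊³ = 0` and
`L₊² ≠ 0`, then there is a real orthogonal matrix `A` that conjugates the family to
`cos(t)·L0 + sin(t)·M` where `M` is one of `M₂, M₃, M₄`; in these three cases
`dim E` equals `2`, `2` and `1`, respectively. -/
theorem statement14 (L1 : Matrix (Fin 5) (Fin 5) ℝ) (hsymm : L1.IsSymm)
    (hiso : Isospectral L1) (h3 : LplusF L1 ^ 3 = 0) (h2 : LplusF L1 ^ 2 ≠ 0) :
    ∃ A : Matrix (Fin 5) (Fin 5) ℝ, A * Aᵀ = 1 ∧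
      (((∀ t : ℝ, A * (Real.cos t • L0d + Real.sin t • L1) * A⁻¹ =
          Real.cos t • L0d + Real.sin t • M₂) ∧ Module.finrank ℝ (Espan L1) = 2) ∨
       ((∀ t : ℝ, A * (Real.cos t • L0d + Real.sin t • L1) * A⁻¹ =
          Real.cos t • L0d + Real.sin t • M₃) ∧ Module.finrank ℝ (Espan L1) = 2) ∨
       ((∀ t : ℝ, A * (Real.cos t • L0d + Real.sin t • L1) * A⁻¹ =
          Real.cos t • L0d + Real.sin t • M₄) ∧ Module.finrank ℝ (Espan L1) = 1)) := by
  have h3' : Real.sqrt 3 ≠ 0 := by positivity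
  obtain ⟨N, hN, rfl⟩ : ∃ N : Matrix (Fin 5) (Fin 5) ℝ, N.IsSymm ∧
      L1 = (Real.sqrt 3)⁻¹ • N :=
    ⟨Real.sqrt 3 • L1, hsymm.smul _, by rw [smul_smul, inv_mul_cancel₀ h3', one_smul]⟩
  rw [eq_of_isSymm hN] at hiso h3 h2 ⊢
  generalize N 0 0 = n0, N 1 1 = n1, N 2 2 = n2, N 3 3 = n3, N 4 4 = n4, N 0 1 = ab,
    N 0 2 = ao, N 0 3 = ac, N 0 4 = ae, N 1 2 = bo, N 1 3 = bc, N 1 4 = be, N 2 3 = oc,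
    N 2 4 = oe, N 3 4 = ce at *
  obtain ⟨rfl, rfl, rfl, rfl, rfl⟩ := diag_eq_zero hiso
  have hr : (Real.sqrt 2 / 2) ^ 2 = 1 / 2 := by
    rw [div_pow, Real.sq_sqrt (by norm_num)]; norm_num
  rcases entries_cases hiso h3 with
    ⟨rfl, rfl, rfl, rfl, rfl, rfl, rfl, rfl, hae, hbc⟩ |
    ⟨rfl, rfl, rfl, rfl, rfl, rfl, rfl, hae, hbo, hoc⟩ |
    ⟨rfl, rfl, rfl, rfl, rfl, rfl, rfl, hbc, hao, hoe⟩ |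
    ⟨rfl, rfl, rfl, rfl, rfl, rfl, hab, hac, hbe, hce⟩
  · exact absurd (LplusF_sq_eq_zero hae hbc) h2
  · obtain ⟨p, hp, rfl⟩ := exists_sign (y := 3) (hae.trans (by norm_num))
    obtain ⟨q, hq, rfl⟩ := exists_sign (hbo.trans hr.symm)
    obtain ⟨r, hr, rfl⟩ := exists_sign (hoc.trans hr.symm)
    obtain ⟨hA, hL, hE⟩ := exists_conj_of_signs (M := M₂) (ε := ![1, q, 1, r, p])
      (N := (Real.sqrt 3)⁻¹ • !![0, 0, 0, 0, p * 3; 0, 0, q * (Real.sqrt 2 / 2), 0, 0;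
        0, q * (Real.sqrt 2 / 2), 0, r * (Real.sqrt 2 / 2), 0;
        0, 0, r * (Real.sqrt 2 / 2), 0, 0; p * 3, 0, 0, 0, 0])
      (by intro i; fin_cases i <;> simp [hp, hq, hr])
      (by
        intro i j
        rw [M₂_eq]
        fin_cases i <;> fin_cases j <;> simp <;> ring_nf)
    exact ⟨_, hA, Or.inl ⟨hL, hE.trans finrank_Espan_M₂⟩⟩
  · have hr' : (3 * (Real.sqrt 2 / 2)) ^ 2 = 9 / 2 := by rw [mul_pow, hr]; norm_num
    obtain ⟨p, hp, rfl⟩ := exists_sign (y := 1) (hbc.trans (by norm_num))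
    obtain ⟨q, hq, rfl⟩ := exists_sign (hao.trans hr'.symm)
    obtain ⟨r, hr, rfl⟩ := exists_sign (hoe.trans hr'.symm)
    obtain ⟨hA, hL, hE⟩ := exists_conj_of_signs (M := M₃) (ε := ![q, 1, 1, p, r])
      (N := (Real.sqrt 3)⁻¹ • !![0, 0, q * (3 * (Real.sqrt 2 / 2)), 0, 0;
        0, 0, 0, p * 1, 0;
        q * (3 * (Real.sqrt 2 / 2)), 0, 0, 0, r * (3 * (Real.sqrt 2 / 2));
        0, p * 1, 0, 0, 0; 0, 0, r * (3 * (Real.sqrt 2 / 2)), 0, 0])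
      (by intro i; fin_cases i <;> simp [hp, hq, hr])
      (by
        intro i j
        rw [M₃_eq]
        fin_cases i <;> fin_cases j <;> simp <;> ring_nf)
    exact ⟨_, hA, Or.inr (Or.inl ⟨hL, hE.trans finrank_Espan_M₃⟩)⟩
  · obtain ⟨p, hp, rfl⟩ := exists_sign (y := 1) (hab.trans (by norm_num))
    obtain ⟨q, hq, rfl⟩ := exists_sign (y := 2) (hac.trans (by norm_num))
    obtain ⟨r, hr, rfl⟩ := exists_sign (y := 2) (hbe.trans (by norm_num))
    obtain rfl : ce = q * (p * r) := by
      linear_combination -(q / 2) * hce - ce * hq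
    obtain ⟨hA, hL, hE⟩ := exists_conj_of_signs (M := M₄) (ε := ![1, p, 1, q, p * r])
      (N := (Real.sqrt 3)⁻¹ • !![0, p * 1, 0, q * 2, 0; p * 1, 0, 0, 0, r * 2; 0, 0, 0, 0, 0;
        q * 2, 0, 0, 0, q * (p * r); 0, r * 2, 0, q * (p * r), 0])
      (by
        intro i
        fin_cases i <;> simp [hp, hq]
        linear_combination r * r * hp + hr)
      (by
        intro i j
        rw [M₄, one_div]
        fin_cases i <;> fin_cases j <;> simp <;> grind)
    exact ⟨_, hA, Or.inr (Or.inr ⟨hL, hE.trans finrank_Espan_M₄⟩)⟩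

end
end

section
/- Let L1 be a real symmetric 5×5 matrix such that the family L(t) := cos(t)·L0 + sin(t)·L1 is isospectral, and suppose L_+^2 = 0. Then there exists a real orthogonal 5×5 matrix A such that A·L(t)·A^{−1} = cos(t)·L0 + sin(t)·M for all t ∈ ℝ, where M = (1/√3)·[[0,0,0,0,3],[0,0,0,1,0],[0,0,0,0,0],[0,1,0,0,0],[3,0,0,0,0]]. In this case dim E = 1. -/
open Matrix Kronecker

noncomputable section

/-- The sixth normal form of `L1`. -/
def M₆ : Matrix (Fin 5) (Fin 5) ℝ :=
  (1 / Real.sqrt 3) •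
    !![0, 0, 0, 0, 3; 0, 0, 0, 1, 0; 0, 0, 0, 0, 0; 0, 1, 0, 0, 0; 3, 0, 0, 0, 0]

/-- The real and imaginary parts of `L₊² = 0`. -/
theorem LplusF_sq_eq_zero_s15 {L1 : Matrix (Fin 5) (Fin 5) ℝ} (h : LplusF L1 ^ 2 = 0) :
    L0d * L1 + L1 * L0d = 0 ∧ L1 * L1 = L0d * L0d := by
  have key : (L0d * L0d - L1 * L1).map Complex.ofReal -
      Complex.I • (L0d * L1 + L1 * L0d).map Complex.ofReal = 0 := by
    have hmul : ∀ A B : Matrix (Fin 5) (Fin 5) ℝ, (A * B).map Complex.ofReal =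
        A.map Complex.ofReal * B.map Complex.ofReal := fun A B =>
      Matrix.map_mul (f := Complex.ofRealHom)
    have h4 : (4 : ℂ) • LplusF L1 ^ 2 = 0 := by rw [h, smul_zero]
    rw [← h4, LplusF, Matrix.map_sub _ Complex.ofReal_sub, Matrix.map_add _ Complex.ofReal_add]
    simp only [hmul, smul_smul, sq, mul_sub, sub_mul, smul_mul_assoc, mul_smul_comm]
    match_scalars <;> grind [Complex.I_sq]
  constructor <;> ext i j
  · have := congrArg Complex.im (congrFun (congrFun key i) j)
    simp at this
    simp only [Matrix.add_apply, Matrix.zero_apply]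
    linarith
  · have := congrArg Complex.re (congrFun (congrFun key i) j)
    simp at this
    linarith

/-- A symmetric `L1` with `L₊² = 0` is antidiagonal, with entries determined up to sign. -/
theorem exists_antidiagonal_of_LplusF_sq_eq_zero {L1 : Matrix (Fin 5) (Fin 5) ℝ}
    (hsymm : L1.IsSymm) (h : LplusF L1 ^ 2 = 0) :
    ∃ a b : ℝ, a ^ 2 = 1 ∧ b ^ 2 = 1 ∧ L1 = !![0, 0, 0, 0, a * √3; 0, 0, 0, b / √3, 0;
      0, 0, 0, 0, 0; 0, b / √3, 0, 0, 0; a * √3, 0, 0, 0, 0] := by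
  obtain ⟨hanti, hsq⟩ := LplusF_sq_eq_zero_s15 h
  have hs : 0 < √3 := by positivity
  have hs2 : √3 ^ 2 = 3 := Real.sq_sqrt (by norm_num)
  have hinv : (√3)⁻¹ = √3 / 3 := by field_simp; linarith
  have hentry : ∀ i j, L1 i j = 0 ∨ L0d i i + L0d j j = 0 := by
    intro i j
    have hij := congrFun (congrFun hanti i) j
    simp only [L0d, Matrix.add_apply, Matrix.diagonal_mul, Matrix.mul_diagonal,
      Matrix.zero_apply] at hij
    rw [← mul_eq_zero]
    simp only [L0d, Matrix.diagonal_apply_eq]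
    linarith
  have hoff : ∀ i j, j ≠ i.rev → L1 i j = 0 := by
    intro i j hij
    refine (hentry i j).resolve_right fun hd => hij ?_
    fin_cases i <;> fin_cases j <;> first
      | rfl
      | (exfalso; simp [L0d, hinv] at hd; try linarith)
  have hdiag := fun i => congrFun (congrFun hsq i) i
  have h04 := hdiag 0
  have h13 := hdiag 1
  have h22 := hdiag 2
  have s40 : L1 4 0 = L1 0 4 := hsymm.apply 0 4
  have s31 : L1 3 1 = L1 1 3 := hsymm.apply 1 3
  simp [L0d, Matrix.mul_apply, Fin.sum_univ_five, hoff 0 0, hoff 0 1, hoff 0 2, hoff 0 3, s40]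
    at h04
  simp [L0d, Matrix.mul_apply, Fin.sum_univ_five, hoff 1 0, hoff 1 1, hoff 1 2, hoff 1 4, s31,
    hinv] at h13
  simp [L0d, Matrix.mul_apply, Fin.sum_univ_five, hoff 2 0, hoff 2 1, hoff 2 3, hoff 2 4] at h22
  refine ⟨L1 0 4 / √3, L1 1 3 * √3, ?_, ?_, ?_⟩
  · field_simp
    linarith
  · rw [mul_pow]
    nlinarith
  · ext i j
    fin_cases i <;> fin_cases j <;> first
      | exact hoff _ _ (by decide)
      | simp [hs.ne', h22, s40, s31]

/-- if `L(t) = cos(t)·L0 + sin(t)·L1` is isospectral with `L₊² = 0`, then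
there is a real orthogonal matrix `A` with `A·L(t)·A⁻¹ = cos(t)·L0 + sin(t)·M₆` for all
`t`; in this case `dim E = 1`. -/
theorem statement15 (L1 : Matrix (Fin 5) (Fin 5) ℝ) (hsymm : L1.IsSymm)
    (hiso : Isospectral L1) (h2 : LplusF L1 ^ 2 = 0) :
    (∃ A : Matrix (Fin 5) (Fin 5) ℝ, A * Aᵀ = 1 ∧
      ∀ t : ℝ, A * (Real.cos t • L0d + Real.sin t • L1) * A⁻¹ =
        Real.cos t • L0d + Real.sin t • M₆) ∧
    Module.finrank ℝ (Espan L1) = 1 := by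
  obtain ⟨a, b, ha, hb, rfl⟩ := exists_antidiagonal_of_LplusF_sq_eq_zero hsymm h2
  have hs : 0 < √3 := by positivity
  have hs2 : √3 ^ 2 = 3 := Real.sq_sqrt (by norm_num)
  constructor
  · have hA : Matrix.diagonal ![a, b, 1, 1, 1] * (Matrix.diagonal ![a, b, 1, 1, 1])ᵀ = 1 := by
      rw [Matrix.diagonal_transpose, Matrix.diagonal_mul_diagonal, ← Matrix.diagonal_one]
      congr 1
      ext i
      fin_cases i <;> simp [← sq, ha, hb]
    refine ⟨Matrix.diagonal ![a, b, 1, 1, 1], hA, fun t => ?_⟩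
    rw [Matrix.inv_eq_right_inv hA, Matrix.diagonal_transpose]
    ext i j
    rw [Matrix.mul_diagonal, Matrix.diagonal_mul]
    fin_cases i <;> fin_cases j <;> simp [L0d, M₆] <;> field_simp <;> grind
  · have hker : ∀ t : ℝ, LinearMap.ker (Real.cos t • L0d + Real.sin t • !![0, 0, 0, 0, a * √3;
        0, 0, 0, b / √3, 0; 0, 0, 0, 0, 0; 0, b / √3, 0, 0, 0;
        a * √3, 0, 0, 0, 0]).mulVecLin = ℝ ∙ (Pi.single 2 1 : Fin 5 → ℝ) := by
      intro t
      have ht := Real.sin_sq_add_cos_sq t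
      ext v
      rw [LinearMap.mem_ker, Matrix.mulVecLin_apply, Submodule.mem_span_singleton]
      constructor
      · intro hv
        have h0 := congrFun hv 0
        have h1 := congrFun hv 1
        have h3 := congrFun hv 3
        have h4 := congrFun hv 4
        simp [L0d, Matrix.mulVec, dotProduct, Fin.sum_univ_five] at h0 h1 h3 h4
        field_simp at h0 h1 h3 h4
        have v0 : v 0 = 0 := by grind
        have v1 : v 1 = 0 := by grind
        have v3 : v 3 = 0 := by grind
        have v4 : v 4 = 0 := by grind
        refine ⟨v 2, ?_⟩
        ext i
        fin_cases i <;> simp [v0, v1, v3, v4]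
      · rintro ⟨r, rfl⟩
        ext i
        fin_cases i <;> simp [L0d, Matrix.mulVec, dotProduct, Fin.sum_univ_five]
    rw [Espan, iSup_congr hker, iSup_const]
    exact finrank_span_singleton (by simp)

end
end

section
/- Let L1 be a real symmetric 5×5 matrix such that the family L(t) := cos(t)·L0 + sin(t)·L1 is isospectral. Then there exists a real orthogonal 5×5 matrix A with A·L0·A^{−1} = L0 such that A·L1·A^{−1} equals one of the following six matrices: (1/(3√3))·[[0,5,0,2,0],[5,0,4,0,2],[0,4,0,4,0],[2,0,4,0,5],[0,2,0,5,0]]; (1/√6)·[[0,0,0,0,3√2],[0,0,1,0,0],[0,1,0,1,0],[0,0,1,0,0],[3√2,0,0,0,0]]; (1/√6)·[[0,0,3,0,0],[0,0,0,√2,0],[3,0,0,0,3],[0,√2,0,0,0],[0,0,3,0,0]]; (1/√3)·[[0,1,0,2,0],[1,0,0,0,2],[0,0,0,0,0],[2,0,0,0,1],[0,2,0,1,0]]; (1/√3)·[[0,√3,0,0,0],[√3,0,0,2,0],[0,0,0,0,0],[0,2,0,0,√3],[0,0,0,√3,0]]; (1/√3)·[[0,0,0,0,3],[0,0,0,1,0],[0,0,0,0,0],[0,1,0,0,0],[3,0,0,0,0]].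 -/
open Matrix Kronecker

noncomputable section

/-- The first normal form of `L1`. -/
def M₁ : Matrix (Fin 5) (Fin 5) ℝ :=
  (1 / (3 * Real.sqrt 3)) •
    !![0, 5, 0, 2, 0; 5, 0, 4, 0, 2; 0, 4, 0, 4, 0; 2, 0, 4, 0, 5; 0, 2, 0, 5, 0]

/-- The fifth normal form of `L1`. -/
def M₅ : Matrix (Fin 5) (Fin 5) ℝ :=
  (1 / Real.sqrt 3) •
    !![0, Real.sqrt 3, 0, 0, 0; Real.sqrt 3, 0, 0, 2, 0; 0, 0, 0, 0, 0;
       0, 2, 0, 0, Real.sqrt 3; 0, 0, 0, Real.sqrt 3, 0]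

/-- `√3 • L0`, with integer entries. -/
def D5 : Matrix (Fin 5) (Fin 5) ℝ :=
  !![3, 0, 0, 0, 0; 0, 1, 0, 0, 0; 0, 0, 0, 0, 0; 0, 0, 0, -1, 0; 0, 0, 0, 0, -3]

lemma D5_eq : D5 = √3 • L0d := by
  have h : √3 * √3 = 3 := Real.mul_self_sqrt (by norm_num)
  ext i j
  fin_cases i <;> fin_cases j <;> simp [D5, L0d, h]

/-- The determinant of `z - x • K0 - y • K1` depends on `x` and `y` only through `x ^ 2 + y ^ 2`,
and on the unit circle it has the roots `0, ±1, ±3` in `z`. -/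
def CircularPair (K0 K1 : Matrix (Fin 5) (Fin 5) ℝ) : Prop :=
  ∀ x y z : ℝ, (z • 1 - x • K0 - y • K1).det =
    z ^ 5 - 10 * (x ^ 2 + y ^ 2) * z ^ 3 + 9 * (x ^ 2 + y ^ 2) ^ 2 * z

lemma Isospectral.circularPair {L1 : Matrix (Fin 5) (Fin 5) ℝ} (h : Isospectral L1) :
    CircularPair D5 (√3 • L1) := by
  intro x y z
  rw [D5_eq]
  set ζ : ℂ := ⟨x, y⟩
  have hx : ‖ζ‖ * Real.cos ζ.arg = x := Complex.norm_mul_cos_arg ζ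
  have hy : ‖ζ‖ * Real.sin ζ.arg = y := Complex.norm_mul_sin_arg ζ
  have hr : ‖ζ‖ ^ 2 = x ^ 2 + y ^ 2 := by
    rw [← hx, ← hy]; linear_combination -‖ζ‖ ^ 2 * Real.sin_sq_add_cos_sq ζ.arg
  generalize ‖ζ‖ = ρ at hx hy hr
  generalize ζ.arg = t at hx hy
  have h3 : √3 ^ 2 = 3 := Real.sq_sqrt (by norm_num)
  rw [← hr]
  rcases eq_or_ne ρ 0 with h0 | h0
  · rw [h0, zero_mul] at hx hy
    subst hx hy h0
    simp
  · have hs : ρ * √3 ≠ 0 := by positivity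
    have key := congrArg (Polynomial.eval (z / (ρ * √3))) (h t)
    rw [Matrix.eval_charpoly] at key
    simp only [Polynomial.eval_mul, Polynomial.eval_X, Polynomial.eval_sub, Polynomial.eval_pow,
      Polynomial.eval_C] at key
    have e : z • (1 : Matrix (Fin 5) (Fin 5) ℝ) - x • (√3 • L0d) - y • (√3 • L1) =
        (ρ * √3) • (Matrix.scalar (Fin 5) (z / (ρ * √3)) -
          (Real.cos t • L0d + Real.sin t • L1)) := by
      rw [← hx, ← hy, Matrix.scalar_apply, ← Matrix.smul_one_eq_diagonal, smul_sub,
        smul_smul (ρ * √3), mul_div_cancel₀ _ hs]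
      module
    rw [e, Matrix.det_smul, key, Fintype.card_fin]
    have : z = (z / (ρ * √3)) * (ρ * √3) := by field_simp
    generalize z / (ρ * √3) = v at *
    subst this
    have h5 : √3 ^ 5 = 9 * √3 := by linear_combination (√3 ^ 3 + 3 * √3) * h3
    have h33 : √3 ^ 3 = 3 * √3 := by linear_combination (√3) * h3
    simp only [mul_pow, h5, h33]
    ring

open InnerProductSpace in
lemma exists_orthogonal_triangular (f : Fin 5 → Fin 5 → ℝ) :
    ∃ O : Matrix (Fin 5) (Fin 5) ℝ, O * Oᵀ = 1 ∧ ∀ i j, i < j → (O *ᵥ f i) j = 0 := by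
  let b := gramSchmidtOrthonormalBasis (𝕜 := ℝ) (E := EuclideanSpace ℝ (Fin 5))
    (by simp) (fun i => WithLp.toLp 2 (f i))
  refine ⟨Matrix.of fun i j => b i j, ?_, fun i j hij => ?_⟩
  · ext i j
    have := b.inner_eq_ite j i
    simp only [PiLp.inner_apply] at this
    simpa [Matrix.mul_apply, Matrix.one_apply, eq_comm (a := i)] using this
  · have := gramSchmidtOrthonormalBasis_inv_triangular (𝕜 := ℝ) (E := EuclideanSpace ℝ (Fin 5))
      (by simp) (fun i => WithLp.toLp 2 (f i)) hij
    change inner ℝ (b j) _ = 0 at this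
    simp only [PiLp.inner_apply] at this
    simpa [Matrix.mulVec, dotProduct, mul_comm] using this

lemma det_fin_five {R : Type*} [CommRing R] (M : Matrix (Fin 5) (Fin 5) R) : M.det =
    (M 0 0 * M 1 1 - M 0 1 * M 1 0) *
      (M 2 2 * (M 3 3 * M 4 4 - M 3 4 * M 4 3) -
        M 2 3 * (M 3 2 * M 4 4 - M 3 4 * M 4 2) +
        M 2 4 * (M 3 2 * M 4 3 - M 3 3 * M 4 2))
    - (M 0 0 * M 1 2 - M 0 2 * M 1 0) *
      (M 2 1 * (M 3 3 * M 4 4 - M 3 4 * M 4 3) -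
        M 2 3 * (M 3 1 * M 4 4 - M 3 4 * M 4 1) +
        M 2 4 * (M 3 1 * M 4 3 - M 3 3 * M 4 1))
    + (M 0 0 * M 1 3 - M 0 3 * M 1 0) *
      (M 2 1 * (M 3 2 * M 4 4 - M 3 4 * M 4 2) -
        M 2 2 * (M 3 1 * M 4 4 - M 3 4 * M 4 1) +
        M 2 4 * (M 3 1 * M 4 2 - M 3 2 * M 4 1))
    - (M 0 0 * M 1 4 - M 0 4 * M 1 0) *
      (M 2 1 * (M 3 2 * M 4 3 - M 3 3 * M 4 2) -
        M 2 2 * (M 3 1 * M 4 3 - M 3 3 * M 4 1) +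
        M 2 3 * (M 3 1 * M 4 2 - M 3 2 * M 4 1))
    + (M 0 1 * M 1 2 - M 0 2 * M 1 1) *
      (M 2 0 * (M 3 3 * M 4 4 - M 3 4 * M 4 3) -
        M 2 3 * (M 3 0 * M 4 4 - M 3 4 * M 4 0) +
        M 2 4 * (M 3 0 * M 4 3 - M 3 3 * M 4 0))
    - (M 0 1 * M 1 3 - M 0 3 * M 1 1) *
      (M 2 0 * (M 3 2 * M 4 4 - M 3 4 * M 4 2) -
        M 2 2 * (M 3 0 * M 4 4 - M 3 4 * M 4 0) +
        M 2 4 * (M 3 0 * M 4 2 - M 3 2 * M 4 0))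
    + (M 0 1 * M 1 4 - M 0 4 * M 1 1) *
      (M 2 0 * (M 3 2 * M 4 3 - M 3 3 * M 4 2) -
        M 2 2 * (M 3 0 * M 4 3 - M 3 3 * M 4 0) +
        M 2 3 * (M 3 0 * M 4 2 - M 3 2 * M 4 0))
    + (M 0 2 * M 1 3 - M 0 3 * M 1 2) *
      (M 2 0 * (M 3 1 * M 4 4 - M 3 4 * M 4 1) -
        M 2 1 * (M 3 0 * M 4 4 - M 3 4 * M 4 0) +
        M 2 4 * (M 3 0 * M 4 1 - M 3 1 * M 4 0))
    - (M 0 2 * M 1 4 - M 0 4 * M 1 2) *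
      (M 2 0 * (M 3 1 * M 4 3 - M 3 3 * M 4 1) -
        M 2 1 * (M 3 0 * M 4 3 - M 3 3 * M 4 0) +
        M 2 3 * (M 3 0 * M 4 1 - M 3 1 * M 4 0))
    + (M 0 3 * M 1 4 - M 0 4 * M 1 3) *
      (M 2 0 * (M 3 1 * M 4 2 - M 3 2 * M 4 1) -
        M 2 1 * (M 3 0 * M 4 2 - M 3 2 * M 4 0) +
        M 2 2 * (M 3 0 * M 4 1 - M 3 1 * M 4 0)) := by
  rw [Matrix.det_succ_row_zero]
  simp only [Fin.sum_univ_five, Matrix.det_succ_row_zero (n := 3), Fin.sum_univ_four,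
    Matrix.det_fin_three, Matrix.submatrix_apply]
  simp [Fin.succAbove, Fin.lt_def]
  ring

set_option maxHeartbeats 4000000 in
lemma CircularPair.diag_eq_zero {e0 e1 e2 e3 e4 a b c d f g p0 p1 p3 p4 : ℝ}
    (h : CircularPair D5 !![e0, a, p0, b, c; a, e1, p1, d, f; p0, p1, e2, p3, p4;
      b, d, p3, e3, g; c, f, p4, g, e4]) : e0 = 0 ∧ e1 = 0 ∧ e2 = 0 ∧ e3 = 0 ∧ e4 = 0 := by
  simp [CircularPair, D5, det_fin_five] at h
  refine ⟨?_, ?_, ?_, ?_, ?_⟩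
  · linear_combination (-1 / 8640) * (45 * (h 1 1 3 - h 1 (-1) 3) - 9 * (h 1 2 3 - h 1 (-2) 3)
      + (h 1 3 3 - h 1 (-3) 3))
  · linear_combination (1 / 960) * (45 * (h 1 1 1 - h 1 (-1) 1) - 9 * (h 1 2 1 - h 1 (-2) 1)
      + (h 1 3 1 - h 1 (-3) 1))
  · linear_combination (-1 / 540) * (45 * (h 1 1 0 - h 1 (-1) 0) - 9 * (h 1 2 0 - h 1 (-2) 0)
      + (h 1 3 0 - h 1 (-3) 0))
  · linear_combination (1 / 960) * (45 * (h 1 1 (-1) - h 1 (-1) (-1)) - 9 * (h 1 2 (-1)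
      - h 1 (-2) (-1)) + (h 1 3 (-1) - h 1 (-3) (-1)))
  · linear_combination (-1 / 8640) * (45 * (h 1 1 (-3) - h 1 (-1) (-3)) - 9 * (h 1 2 (-3)
      - h 1 (-2) (-3)) + (h 1 3 (-3) - h 1 (-3) (-3)))

set_option maxHeartbeats 4000000 in
lemma CircularPair.isotropic {a b c d f g p0 p1 p3 p4 w0 w1 w3 w4 u0 u1 u3 u4 : ℝ}
    (h : CircularPair D5 !![0, a, p0, b, c; a, 0, p1, d, f; p0, p1, 0, p3, p4;
      b, d, p3, 0, g; c, f, p4, g, 0])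
    (hw0 : 3 * w0 = -p0) (hw1 : w1 = -p1) (hw3 : -w3 = -p3) (hw4 : -3 * w4 = -p4)
    (hu0 : 3 * u0 = -(a * w1 + b * w3 + c * w4)) (hu1 : u1 = -(a * w0 + d * w3 + f * w4))
    (hu3 : -u3 = -(b * w0 + d * w1 + g * w4)) (hu4 : -3 * u4 = -(c * w0 + f * w1 + g * w3)) :
    3 * w0 ^ 2 + w1 ^ 2 - w3 ^ 2 - 3 * w4 ^ 2 = 0 ∧
    a * w0 * w1 + b * w0 * w3 + c * w0 * w4 + d * w1 * w3 + f * w1 * w4 + g * w3 * w4 = 0 ∧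
    3 * u0 ^ 2 + u1 ^ 2 - u3 ^ 2 - 3 * u4 ^ 2 = 0 ∧
    a * u0 * u1 + b * u0 * u3 + c * u0 * u4 + d * u1 * u3 + f * u1 * u4 + g * u3 * u4 = 0 := by
  simp [CircularPair, D5, det_fin_five] at h
  obtain rfl : p0 = -3 * w0 := by linarith
  obtain rfl : p1 = -w1 := by linarith
  obtain rfl : w3 = p3 := by linarith
  obtain rfl : p4 = 3 * w4 := by linarith
  obtain rfl : u0 = -(a * w1 + b * w3 + c * w4) / 3 := by linarith
  obtain rfl : u1 = -(a * w0 + d * w3 + f * w4) := by linarith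
  obtain rfl : u3 = (b * w0 + d * w1 + g * w4) := by linarith
  obtain rfl : u4 = (c * w0 + f * w1 + g * w3) / 3 := by linarith
  have h2 : 3 * w0 ^ 2 + w1 ^ 2 - w3 ^ 2 - 3 * w4 ^ 2 = 0 := by
    linear_combination (1/9) * (16 * (h 1 1 0 + h 1 (-1) 0) - (h 1 2 0 + h 1 (-2) 0))/24
  have h3 : a * w0 * w1 + b * w0 * w3 + c * w0 * w4 + d * w1 * w3 + f * w1 * w4
    + g * w3 * w4 = 0 := by
    linear_combination (-1/18) * (32 * (h 1 1 0 - h 1 (-1) 0) - (h 1 2 0 - h 1 (-2) 0))/48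
  refine ⟨h2, h3, ?_, ?_⟩
  · linear_combination (1/9) * ((h 1 2 0 + h 1 (-2) 0) - 4 * (h 1 1 0 + h 1 (-1) 0))/24 -
      (-a^2/3+b^2/3+c^2/9+d^2+f^2/3-g^2/3) * h2
  · linear_combination (-1/18) * ((h 1 2 0 - h 1 (-2) 0) - 8 * (h 1 1 0 - h 1 (-1) 0))/48 -
      (-a^2/3+b^2/3+c^2/9+d^2+f^2/3-g^2/3) * h3 + (-a*b*d/3-a*c*f/9+b*c*g/9+d*f*g/3) * h2

set_option maxHeartbeats 4000000 in
lemma CircularPair.quartic {a b c d f g : ℝ}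
    (h : CircularPair D5 !![0, a, 0, b, c; a, 0, 0, d, f; 0, 0, 0, 0, 0;
      b, d, 0, 0, g; c, f, 0, g, 0]) :
    6 * a ^ 2 + 3 * b ^ 2 + 2 * c ^ 2 = 18 ∧ -2 * a ^ 2 + 2 * d ^ 2 + f ^ 2 = 2 ∧
    -b ^ 2 - 2 * d ^ 2 + 2 * g ^ 2 = -2 ∧ 2 * c ^ 2 + 3 * f ^ 2 + 6 * g ^ 2 = 18 ∧
    a * b * d = b * c * g + 2 * (d * f * g) ∧ a * c * f = - 2 * (b * c * g) - 3 * (d * f * g) ∧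
    (a * g) ^ 2 + (b * f) ^ 2 + (c * d) ^ 2 - 2 * (a * g) * (b * f) - 2 * (a * g) * (c * d)
      - 2 * (b * f) * (c * d) = 9 := by
  simp [CircularPair, D5, det_fin_five] at h
  have e0 := h 1 1 3
  have e1 := h 1 (-1) 3
  have e2 := h 1 1 1
  have e3 := h 1 (-1) 1
  have e4 := h 1 1 (-1)
  have e5 := h 1 (-1) (-1)
  have e6 := h 1 1 (-3)
  have e7 := h 1 (-1) (-3)
  have e8 := h 1 1 2
  have e9 := h 1 (-1) 2
  ring_nf at e0 e1 e2 e3 e4 e5 e6 e7 e8 e9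
  have e10 := h 0 1 1
  have e11 := h 0 1 (-1)
  have e12 := h 1 2 1
  have e13 := h 1 2 (-1)
  have e14 := h 1 2 3
  have e15 := h 1 2 (-3)
  ring_nf at e10 e11 e12 e13 e14 e15
  refine ⟨?_, ?_, ?_, ?_, ?_, ?_, ?_⟩ <;> linarith

lemma quartic_generic_aux {ρ A B C D F G : ℝ} (hG0 : 0 < G) (hF0 : 0 < F)
    (h2 : -2 * A + 2 * D + F = 2) (h4 : 2 * C + 3 * F + 6 * G = 18)
    (h7' : A * G + B * F + C * D - 2 * ((ρ + 2) * F * G)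
      + 2 * ((2 * ρ + 3) * D * G) - 2 * (ρ * D * F) = 9)
    (hρ0 : ρ ≠ 0) (hρ2 : ρ + 2 ≠ 0) (hρ3 : 2 * ρ + 3 ≠ 0)
    (hA : A = -(ρ + 2) * (2 * ρ + 3) * G / ρ) (hB : B = -(ρ + 2) * ρ * F / (2 * ρ + 3))
    (hC : C = -(2 * ρ + 3) * ρ * D / (ρ + 2)) (hF : ρ * F = -4 * (2 * ρ + 3) * G) :
    (ρ + 1) ^ 4 * (ρ + 3) ^ 4 = 0 := by
  have hF' : F = -4 * (2 * ρ + 3) * G / ρ := by field_simp; linear_combination hF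
  have hD' : D = 1 - (2 * ρ + 3) * G := by
    have : 2 * D = 2 + 2 * A - F := by linarith
    rw [hA, hF'] at this
    field_simp at this
    have : ρ * D = ρ * (1 - (2 * ρ + 3) * G) := by linear_combination this / 2
    exact mul_left_cancel₀ hρ0 this
  have hE : 2 * (ρ ^ 2 + 3 * ρ + 3) * (ρ ^ 2 - 3) * G = ρ * (ρ + 3) ^ 2 := by
    have := h4
    rw [hC, hF', hD'] at this
    field_simp at this
    linear_combination this / 4
  have hneg : ρ * (2 * ρ + 3) < 0 := by
    have : 0 < ρ ^ 2 * F := by positivity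
    by_contra! hh
    have h1 := mul_nonneg hh hG0.le
    have h2 : ρ ^ 2 * F = -4 * (ρ * (2 * ρ + 3) * G) := by linear_combination ρ * hF
    linarith
  have hlt : ρ < 0 := by
    by_contra! hh
    have := mul_nonneg hh (by linarith : (0 : ℝ) ≤ 2 * ρ + 3)
    linarith
  have hgt : -3 / 2 < ρ := by
    by_contra! hh
    have := mul_nonneg_of_nonpos_of_nonpos hlt.le (by linarith : 2 * ρ + 3 ≤ 0)
    linarith
  have e1 : ρ ^ 2 + 3 * ρ + 3 ≠ 0 := by
    have := sq_nonneg (ρ + 3 / 2)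
    intro h
    linarith
  have e2 : ρ ^ 2 - 3 ≠ 0 := by
    apply ne_of_lt
    nlinarith
  have hE0 : 2 * (ρ ^ 2 + 3 * ρ + 3) * (ρ ^ 2 - 3) ≠ 0 := by
    exact mul_ne_zero (mul_ne_zero two_ne_zero e1) e2
  have hG' : G = ρ * (ρ + 3) ^ 2 / (2 * (ρ ^ 2 + 3 * ρ + 3) * (ρ ^ 2 - 3)) := by
    rw [eq_div_iff hE0]; linarith
  have e1' : ρ * (ρ + 3) + 3 ≠ 0 := by convert e1 using 1; ring
  have := h7'
  rw [hA, hB, hC, hF', hD', hG'] at this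
  field_simp at this
  refine mul_right_cancel₀ hρ2 ?_
  linear_combination this / (-36)

lemma quartic_generic {a b c d f g : ℝ}
    (h1 : 6 * a ^ 2 + 3 * b ^ 2 + 2 * c ^ 2 = 18) (h2 : -2 * a ^ 2 + 2 * d ^ 2 + f ^ 2 = 2)
    (h3 : -b ^ 2 - 2 * d ^ 2 + 2 * g ^ 2 = -2) (h4 : 2 * c ^ 2 + 3 * f ^ 2 + 6 * g ^ 2 = 18)
    (h5 : a * b * d = b * c * g + 2 * (d * f * g))
    (h6 : a * c * f = -2 * (b * c * g) - 3 * (d * f * g))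
    (h7 : (a * g) ^ 2 + (b * f) ^ 2 + (c * d) ^ 2 - 2 * (a * g) * (b * f) - 2 * (a * g) * (c * d)
      - 2 * (b * f) * (c * d) = 9) : d * f * g = 0 := by
  by_contra hT
  have hd : d ≠ 0 := by rintro rfl; simp at hT
  have hf : f ≠ 0 := by rintro rfl; simp at hT
  have hg : g ≠ 0 := by rintro rfl; simp at hT
  obtain ⟨ρ, hρ⟩ : ∃ ρ, b * c * g = ρ * (d * f * g) := ⟨b * c * g / (d * f * g), by field_simp⟩
  have hbc : b * c = ρ * d * f := mul_right_cancel₀ hg (by linear_combination hρ)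
  rw [hρ] at h5 h6
  have hab : a * b = (ρ + 2) * f * g := mul_right_cancel₀ hd (by linear_combination h5)
  have hac : a * c = -(2 * ρ + 3) * d * g := mul_right_cancel₀ hf (by linear_combination h6)
  have ha : ρ * a ^ 2 = -(ρ + 2) * (2 * ρ + 3) * g ^ 2 := by
    refine mul_right_cancel₀ (mul_ne_zero hd hf) ?_
    linear_combination -a ^ 2 * hbc + a * c * hab + (ρ + 2) * f * g * hac
  have hb : (2 * ρ + 3) * b ^ 2 = -(ρ + 2) * ρ * f ^ 2 := by
    refine mul_right_cancel₀ (mul_ne_zero hd hg) ?_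
    linear_combination b ^ 2 * hac - a * b * hbc - ρ * d * f * hab
  have hc : (ρ + 2) * c ^ 2 = -(2 * ρ + 3) * ρ * d ^ 2 := by
    refine mul_right_cancel₀ (mul_ne_zero hf hg) ?_
    linear_combination -c ^ 2 * hab + a * c * hbc + ρ * d * f * hac
  have hd2 : 0 < d ^ 2 := by positivity
  have hf2 : 0 < f ^ 2 := by positivity
  have hg2 : 0 < g ^ 2 := by positivity
  have k1 : (a * g) * (b * f) = (ρ + 2) * f ^ 2 * g ^ 2 := by linear_combination f * g * hab
  have k2 : (a * g) * (c * d) = -(2 * ρ + 3) * d ^ 2 * g ^ 2 := by linear_combination d * g * hac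
  have k3 : (b * f) * (c * d) = ρ * d ^ 2 * f ^ 2 := by linear_combination d * f * hbc
  have h7' : a ^ 2 * g ^ 2 + b ^ 2 * f ^ 2 + c ^ 2 * d ^ 2 - 2 * ((ρ + 2) * f ^ 2 * g ^ 2)
      + 2 * ((2 * ρ + 3) * d ^ 2 * g ^ 2) - 2 * (ρ * d ^ 2 * f ^ 2) = 9 := by
    linear_combination h7 + 2 * k1 + 2 * k2 + 2 * k3
  clear h5 h6 h7 hρ hT k1 k2 k3 hbc hab hac
  have ha0 := sq_nonneg a
  have hb0 := sq_nonneg b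
  have hc0 := sq_nonneg c
  clear hd hf hg
  generalize a ^ 2 = A at *
  generalize b ^ 2 = B at *
  generalize c ^ 2 = C at *
  generalize d ^ 2 = D at *
  generalize f ^ 2 = F at *
  generalize g ^ 2 = G at *
  have hρ0 : ρ ≠ 0 := by rintro rfl; nlinarith
  have hρ2 : ρ + 2 ≠ 0 := by
    intro h; obtain rfl : ρ = -2 := by linarith
    nlinarith
  have hρ3 : 2 * ρ + 3 ≠ 0 := by
    intro h; obtain rfl : ρ = -3/2 := by linarith
    nlinarith
  have hA : A = -(ρ + 2) * (2 * ρ + 3) * G / ρ := by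
    rw [eq_div_iff (by assumption)]; linear_combination ha
  have hB : B = -(ρ + 2) * ρ * F / (2 * ρ + 3) := by
    rw [eq_div_iff (by assumption)]; linear_combination hb
  have hC : C = -(2 * ρ + 3) * ρ * D / (ρ + 2) := by
    rw [eq_div_iff (by assumption)]; linear_combination hc
  have hprod : ρ * ((ρ + 1) * (ρ + 3)) * F = -4 * (2 * ρ + 3) * ((ρ + 1) * (ρ + 3)) * G := by
    have e : 2 * G - 2 * A + F - B = 0 := by linarith
    rw [hA, hB] at e
    field_simp at e
    linear_combination e
  by_cases h13 : (ρ + 1) * (ρ + 3) = 0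
  · rcases mul_eq_zero.1 h13 with h | h
    · obtain rfl : ρ = -1 := by linarith
      norm_num at hA hB hC
      obtain rfl : F = 8 - 4 * G := by linarith
      obtain rfl : D = 3 * G - 3 := by linarith
      rw [hA, hB, hC] at h7'
      have : (G - 1) ^ 2 = 0 := by linear_combination h7' / 16
      have := pow_eq_zero_iff (two_ne_zero) |>.1 this
      linarith
    · obtain rfl : ρ = -3 := by linarith
      norm_num at hA hB hC
      obtain rfl : F = 4 - 4 * D := by linarith
      obtain rfl : G = 1 - D := by linarith
      rw [hA, hB, hC] at h7'
      have : (D - 1) ^ 2 = 0 := by linear_combination h7' / 16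
      have := pow_eq_zero_iff (two_ne_zero) |>.1 this
      linarith
  · have hF : ρ * F = -4 * (2 * ρ + 3) * G := mul_right_cancel₀ h13 (by linear_combination hprod)
    exact h13 (pow_eq_zero_iff (n := 4) (by norm_num) |>.1 (by
      rw [mul_pow]
      exact quartic_generic_aux hg2 hf2 h2 h4 h7' hρ0 hρ2 hρ3 hA hB hC hF))

lemma quartic_cases_of_eq_zero {b c d f g : ℝ}
    (h1 : 3 * b ^ 2 + 2 * c ^ 2 = 18) (h2 : 2 * d ^ 2 + f ^ 2 = 2)
    (h3 : -b ^ 2 - 2 * d ^ 2 + 2 * g ^ 2 = -2) (h4 : 2 * c ^ 2 + 3 * f ^ 2 + 6 * g ^ 2 = 18)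
    (h5 : b * c * g = 0) (h6 : d * f * g = 0)
    (h7 : (b * f) ^ 2 + (c * d) ^ 2 - 2 * (b * f) * (c * d) = 9) :
    b = 0 ∧ f = 0 ∧ g = 0 ∧ c ^ 2 = 9 ∧ d ^ 2 = 1 := by
  have hg0 : g = 0 := by
    by_contra hg
    have hg2 : 0 < g ^ 2 := by positivity
    rcases mul_eq_zero.1 ((mul_eq_zero.1 h5).resolve_right hg) with hb | hc
    · subst hb
      have := sq_nonneg f
      nlinarith
    · subst hc
      rcases mul_eq_zero.1 ((mul_eq_zero.1 h6).resolve_right hg) with hd | hf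
      · subst hd
        have e1 : b ^ 2 = 6 := by linarith
        have e2 : f ^ 2 = 2 := by linarith
        have : (b * f) ^ 2 = 12 := by rw [mul_pow, e1, e2]; norm_num
        linarith
      · subst hf
        norm_num at h7
  subst hg0
  have eb : b ^ 2 = 2 - 2 * d ^ 2 := by linarith
  have ef : f ^ 2 = 2 - 2 * d ^ 2 := by linarith
  have ec : c ^ 2 = 6 + 3 * d ^ 2 := by linarith
  have hd1 : d ^ 2 ≤ 1 := by have := sq_nonneg f; linarith
  have key : (1 - d ^ 2) ^ 3 * (25 - d ^ 2) = 0 := by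
    have e1 : (b * f) ^ 2 = (2 - 2 * d ^ 2) ^ 2 := by rw [mul_pow, eb, ef]; ring
    have e2 : (c * d) ^ 2 = (6 + 3 * d ^ 2) * d ^ 2 := by rw [mul_pow, ec]
    have e3 : 2 * (b * f) * (c * d) = (2 - 2 * d ^ 2) ^ 2 + (6 + 3 * d ^ 2) * d ^ 2 - 9 := by
      linarith
    have e4 : 4 * ((2 - 2 * d ^ 2) ^ 2 * ((6 + 3 * d ^ 2) * d ^ 2)) =
        ((2 - 2 * d ^ 2) ^ 2 + (6 + 3 * d ^ 2) * d ^ 2 - 9) ^ 2 := by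
      rw [← e3, ← e1, ← e2]; ring
    linear_combination -e4
  have hd : d ^ 2 = 1 := by
    rcases mul_eq_zero.1 key with h | h
    · have := pow_eq_zero_iff (by norm_num) |>.1 h
      linarith
    · linarith
  rw [hd] at eb ef ec
  exact ⟨by simpa using eb, by simpa using ef, rfl, by linarith, hd⟩

lemma quartic_cases {a b c d f g : ℝ}
    (h1 : 6 * a ^ 2 + 3 * b ^ 2 + 2 * c ^ 2 = 18) (h2 : -2 * a ^ 2 + 2 * d ^ 2 + f ^ 2 = 2)
    (h3 : -b ^ 2 - 2 * d ^ 2 + 2 * g ^ 2 = -2) (h4 : 2 * c ^ 2 + 3 * f ^ 2 + 6 * g ^ 2 = 18)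
    (h5 : a * b * d = b * c * g + 2 * (d * f * g))
    (h6 : a * c * f = -2 * (b * c * g) - 3 * (d * f * g))
    (h7 : (a * g) ^ 2 + (b * f) ^ 2 + (c * d) ^ 2 - 2 * (a * g) * (b * f) - 2 * (a * g) * (c * d)
      - 2 * (b * f) * (c * d) = 9) :
    (c = 0 ∧ d = 0 ∧ a ^ 2 = 1 ∧ g ^ 2 = 1 ∧ b ^ 2 = 4 ∧ f ^ 2 = 4 ∧ a * g * (b * f) = 4) ∨
    (b = 0 ∧ c = 0 ∧ f = 0 ∧ a ^ 2 = 3 ∧ g ^ 2 = 3 ∧ d ^ 2 = 4) ∨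
    (a = 0 ∧ b = 0 ∧ f = 0 ∧ g = 0 ∧ c ^ 2 = 9 ∧ d ^ 2 = 1) := by
  have hT := quartic_generic h1 h2 h3 h4 h5 h6 h7
  rw [hT] at h5 h6
  have hR : b * c * g = 0 := by
    have e3 : a * b * d * (a * c * f) * g ^ 2 = b * c * g * (d * f * g) * a ^ 2 := by ring
    rw [h5, h6, hT] at e3
    have : (b * c * g * g) ^ 2 = 0 := by linear_combination -e3 / 2
    have := pow_eq_zero_iff (by norm_num) |>.1 this
    rcases mul_eq_zero.1 this with h | h
    · exact h
    · rw [h, mul_zero]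
  rw [hR] at h5 h6
  norm_num at h5 h6
  by_cases ha : a = 0
  · subst ha
    obtain ⟨rfl, rfl, rfl, hc, hd⟩ := quartic_cases_of_eq_zero (b := b) (c := c) (d := d) (f := f)
      (g := g) (by linarith) (by linarith) h3 h4 hR hT (by linarith)
    exact .inr (.inr ⟨rfl, rfl, rfl, rfl, hc, hd⟩)
  by_cases hg : g = 0
  · subst hg
    obtain ⟨rfl, rfl, rfl, hc, hd⟩ := quartic_cases_of_eq_zero (b := f) (c := c) (d := d) (f := b)
      (g := a) (by linarith) (by linarith) (by linarith) (by linarith) (by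
        rcases h6 with (h | h) | h
        · exact absurd h ha
        · simp [h]
        · simp [h]) (by
        rcases h5 with (h | h) | h
        · exact absurd h ha
        · simp [h]
        · simp [h]) (by linarith)
    exact absurd rfl ha
  have hbd : b = 0 ∨ d = 0 := by tauto
  have hcf : c = 0 ∨ f = 0 := by tauto
  have hbc : b = 0 ∨ c = 0 := by simpa [hg] using hR
  have hdf : d = 0 ∨ f = 0 := by simpa [hg] using hT
  by_cases hb : b = 0
  · subst hb
    by_cases hc : c = 0
    · subst hc
      have ha2 : a ^ 2 = 3 := by linarith
      rcases hdf with hd | hf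
      · subst hd
        have := sq_nonneg g
        linarith
      · subst hf
        refine .inr (.inl ⟨rfl, rfl, rfl, ha2, ?_, ?_⟩) <;> linarith
    · obtain rfl : f = 0 := by tauto
      exfalso
      have eg : g ^ 2 = a ^ 2 := by linarith
      have ed : d ^ 2 = 1 + a ^ 2 := by linarith
      have ec : c ^ 2 = 9 - 3 * a ^ 2 := by linarith
      have e1 : (a * g) ^ 2 = a ^ 2 * a ^ 2 := by rw [mul_pow, eg]
      have e2 : (c * d) ^ 2 = (9 - 3 * a ^ 2) * (1 + a ^ 2) := by rw [mul_pow, ec, ed]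
      have e4 : 4 * (a ^ 2 * a ^ 2 * ((9 - 3 * a ^ 2) * (1 + a ^ 2))) =
          (a ^ 2 * a ^ 2 + (9 - 3 * a ^ 2) * (1 + a ^ 2) - 9) ^ 2 := by
        rw [← e1, ← e2]
        linear_combination
          (2 * (a * g) * (c * d) + (a * g) ^ 2 + (c * d) ^ 2 - 9) * (-1) * h7
      have ha2 : 0 < a ^ 2 := by positivity
      have : (a ^ 2) ^ 3 * (16 * a ^ 2 - 48) = 0 := by linear_combination -e4
      rcases mul_eq_zero.1 this with h | h
      · exact ha2.ne' (pow_eq_zero_iff (by norm_num) |>.1 h)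
      · exact hc (pow_eq_zero_iff (n := 2) (by norm_num) |>.1 (by linarith))
  · obtain rfl : c = 0 := by tauto
    obtain rfl : d = 0 := by tauto
    have eg : g ^ 2 = 2 - a ^ 2 := by linarith
    have eb : b ^ 2 = 6 - 2 * a ^ 2 := by linarith
    have ef : f ^ 2 = 2 + 2 * a ^ 2 := by linarith
    have e1 : (a * g) ^ 2 = a ^ 2 * (2 - a ^ 2) := by rw [mul_pow, eg]
    have e2 : (b * f) ^ 2 = (6 - 2 * a ^ 2) * (2 + 2 * a ^ 2) := by rw [mul_pow, eb, ef]
    have e4 : 4 * (a ^ 2 * (2 - a ^ 2) * ((6 - 2 * a ^ 2) * (2 + 2 * a ^ 2))) =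
        (a ^ 2 * (2 - a ^ 2) + (6 - 2 * a ^ 2) * (2 + 2 * a ^ 2) - 9) ^ 2 := by
      rw [← e1, ← e2]
      linear_combination
        (2 * (a * g) * (b * f) + (a * g) ^ 2 + (b * f) ^ 2 - 9) * (-1) * h7
    have : (a ^ 2 - 1) ^ 4 = 0 := by linear_combination -e4 / 9
    have ha2 : a ^ 2 = 1 := by linarith [pow_eq_zero_iff (by norm_num) |>.1 this]
    rw [ha2] at eg eb ef e1 e2
    refine .inl ⟨rfl, rfl, ha2, ?_, ?_, ?_, ?_⟩ <;> linarith

/-- `√3` times the first normal form. -/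
def N₁ : Matrix (Fin 5) (Fin 5) ℝ :=
  !![0, 5 / 3, 0, 2 / 3, 0; 5 / 3, 0, 4 / 3, 0, 2 / 3; 0, 4 / 3, 0, 4 / 3, 0;
    2 / 3, 0, 4 / 3, 0, 5 / 3; 0, 2 / 3, 0, 5 / 3, 0]

/-- `√3` times the second normal form. -/
def N₂ : Matrix (Fin 5) (Fin 5) ℝ :=
  !![0, 0, 0, 0, 3; 0, 0, √2 / 2, 0, 0; 0, √2 / 2, 0, √2 / 2, 0; 0, 0, √2 / 2, 0, 0; 3, 0, 0, 0, 0]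

/-- `√3` times the third normal form. -/
def N₃ : Matrix (Fin 5) (Fin 5) ℝ :=
  !![0, 0, 3 * √2 / 2, 0, 0; 0, 0, 0, 1, 0; 3 * √2 / 2, 0, 0, 0, 3 * √2 / 2; 0, 1, 0, 0, 0;
    0, 0, 3 * √2 / 2, 0, 0]

/-- `√3` times the fourth normal form. -/
def N₄ : Matrix (Fin 5) (Fin 5) ℝ :=
  !![0, 1, 0, 2, 0; 1, 0, 0, 0, 2; 0, 0, 0, 0, 0; 2, 0, 0, 0, 1; 0, 2, 0, 1, 0]

/-- `√3` times the fifth normal form. -/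
def N₅ : Matrix (Fin 5) (Fin 5) ℝ :=
  !![0, √3, 0, 0, 0; √3, 0, 0, 2, 0; 0, 0, 0, 0, 0; 0, 2, 0, 0, √3; 0, 0, 0, √3, 0]

/-- `√3` times the sixth normal form. -/
def N₆ : Matrix (Fin 5) (Fin 5) ℝ :=
  !![0, 0, 0, 0, 3; 0, 0, 0, 1, 0; 0, 0, 0, 0, 0; 0, 1, 0, 0, 0; 3, 0, 0, 0, 0]

/-- Some orthogonal matrix conjugates `K0` to `D5` and `K1` to one of `N₁, …, N₆`. -/
def HasNormalForm (K0 K1 : Matrix (Fin 5) (Fin 5) ℝ) : Prop :=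
  ∃ U : Matrix (Fin 5) (Fin 5) ℝ, U * Uᵀ = 1 ∧ U * K0 * Uᵀ = D5 ∧
    (U * K1 * Uᵀ = N₁ ∨ U * K1 * Uᵀ = N₂ ∨ U * K1 * Uᵀ = N₃ ∨
      U * K1 * Uᵀ = N₄ ∨ U * K1 * Uᵀ = N₅ ∨ U * K1 * Uᵀ = N₆)

lemma HasNormalForm.of_conj {K0 K1 O : Matrix (Fin 5) (Fin 5) ℝ} (hO : O * Oᵀ = 1)
    (h : HasNormalForm (O * K0 * Oᵀ) (O * K1 * Oᵀ)) : HasNormalForm K0 K1 := by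
  obtain ⟨U, hU, h0, h1⟩ := h
  have e (K : Matrix (Fin 5) (Fin 5) ℝ) : U * O * K * (U * O)ᵀ = U * (O * K * Oᵀ) * Uᵀ := by
    simp only [Matrix.transpose_mul, Matrix.mul_assoc]
  refine ⟨U * O, ?_, ?_, ?_⟩
  · simpa [hO, hU] using e 1
  · rw [e, h0]
  · simpa only [e] using h1

lemma CircularPair.conj {K0 K1 O : Matrix (Fin 5) (Fin 5) ℝ} (h : CircularPair K0 K1)
    (hO : O * Oᵀ = 1) : CircularPair (O * K0 * Oᵀ) (O * K1 * Oᵀ) := by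
  intro x y z
  rw [← h x y z]
  have e : z • (1 : Matrix (Fin 5) (Fin 5) ℝ) - x • (O * K0 * Oᵀ) - y • (O * K1 * Oᵀ) =
      O * (z • 1 - x • K0 - y • K1) * Oᵀ := by
    simp [Matrix.mul_sub, Matrix.sub_mul, hO]
  have hd : O.det * Oᵀ.det = 1 := by rw [← Matrix.det_mul, hO, Matrix.det_one]
  rw [e, Matrix.det_mul, Matrix.det_mul]
  linear_combination (z • 1 - x • K0 - y • K1).det * hd

lemma N_eq_smul : N₁ = √3 • M₁ ∧ N₂ = √3 • M₂ ∧ N₃ = √3 • M₃ ∧ N₄ = √3 • M₄ ∧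
    N₅ = √3 • M₅ ∧ N₆ = √3 • M₆ := by
  have h3 : √3 ≠ 0 := by positivity
  have h2 : √2 ≠ 0 := by positivity
  have h22 : √2 ^ 2 = 2 := Real.sq_sqrt (by norm_num)
  have h6 : √6 = √3 * √2 := by rw [← Real.sqrt_mul (by norm_num)]; norm_num
  have e1 : √3 * (1 / (3 * √3)) = 1 / 3 := by field_simp
  have e2 : √3 * (1 / √6) = √2 / 2 := by rw [h6]; field_simp; rw [h22]
  have e3 : √3 * (1 / √3) = 1 := by field_simp
  refine ⟨?_, ?_, ?_, ?_, ?_, ?_⟩ <;>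
    simp only [N₁, M₁, N₂, M₂, N₃, M₃, N₄, M₄, N₅, M₅, N₆, M₆, smul_smul, e1, e2, e3, one_smul] <;>
    ext i j <;> fin_cases i <;> fin_cases j <;> simp <;> norm_num <;> linarith

lemma HasNormalForm.exists_conj {L1 : Matrix (Fin 5) (Fin 5) ℝ} (h : HasNormalForm D5 (√3 • L1)) :
    ∃ A : Matrix (Fin 5) (Fin 5) ℝ, A * Aᵀ = 1 ∧ A * L0d * A⁻¹ = L0d ∧
      (A * L1 * A⁻¹ = M₁ ∨ A * L1 * A⁻¹ = M₂ ∨ A * L1 * A⁻¹ = M₃ ∨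
       A * L1 * A⁻¹ = M₄ ∨ A * L1 * A⁻¹ = M₅ ∨ A * L1 * A⁻¹ = M₆) := by
  obtain ⟨A, hA, h0, h1⟩ := h
  have h3 : √3 ≠ 0 := by positivity
  obtain ⟨e1, e2, e3, e4, e5, e6⟩ := N_eq_smul
  rw [D5_eq] at h0
  refine ⟨A, hA, ?_⟩
  rw [Matrix.inv_eq_right_inv hA]
  simp only [e1, e2, e3, e4, e5, e6, Matrix.mul_smul, Matrix.smul_mul,
    (smul_right_injective _ h3).eq_iff] at h0 h1
  exact ⟨h0, h1⟩

lemma hasNormalForm_of_quartic {a b c d f g : ℝ}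
    (h : (c = 0 ∧ d = 0 ∧ a ^ 2 = 1 ∧ g ^ 2 = 1 ∧ b ^ 2 = 4 ∧ f ^ 2 = 4 ∧ a * g * (b * f) = 4) ∨
    (b = 0 ∧ c = 0 ∧ f = 0 ∧ a ^ 2 = 3 ∧ g ^ 2 = 3 ∧ d ^ 2 = 4) ∨
    (a = 0 ∧ b = 0 ∧ f = 0 ∧ g = 0 ∧ c ^ 2 = 9 ∧ d ^ 2 = 1)) :
    HasNormalForm D5 !![0, a, 0, b, c; a, 0, 0, d, f; 0, 0, 0, 0, 0;
      b, d, 0, 0, g; c, f, 0, g, 0] := by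
  have key (ε1 ε3 ε4 : ℝ) (h1 : ε1 ^ 2 = 1) (h3 : ε3 ^ 2 = 1) (h4 : ε4 ^ 2 = 1) :
      let U : Matrix (Fin 5) (Fin 5) ℝ := Matrix.diagonal ![1, ε1, 1, ε3, ε4]
      U * Uᵀ = 1 ∧ U * D5 * Uᵀ = D5 ∧ ∀ a b c d f g : ℝ,
      U * !![0, a, 0, b, c; a, 0, 0, d, f; 0, 0, 0, 0, 0; b, d, 0, 0, g; c, f, 0, g, 0] * Uᵀ =
      !![0, ε1 * a, 0, ε3 * b, ε4 * c; ε1 * a, 0, 0, ε1 * ε3 * d, ε1 * ε4 * f; 0, 0, 0, 0, 0;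
        ε3 * b, ε1 * ε3 * d, 0, 0, ε3 * ε4 * g; ε4 * c, ε1 * ε4 * f, 0, ε3 * ε4 * g, 0] := by
    intro U
    refine ⟨?_, ?_, fun a b c d f g => ?_⟩
    · ext i j; fin_cases i <;> fin_cases j <;> simp [U] <;> linarith
    · ext i j; fin_cases i <;> fin_cases j <;> simp [U, D5] <;> linarith
    · ext i j; fin_cases i <;> fin_cases j <;> simp [U] <;> ring
  rcases h with ⟨rfl, rfl, ha, hg, hb, hf, h⟩ | ⟨rfl, rfl, rfl, ha, hg, hd⟩ |
    ⟨rfl, rfl, rfl, rfl, hc, hd⟩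
  · obtain ⟨k1, k2, k3⟩ := key a (b / 2) (a * f / 2) ha (by linarith)
      (by linear_combination (f ^ 2 * ha + hf) / 4)
    refine ⟨_, k1, k2, .inr (.inr (.inr (.inl ?_)))⟩
    rw [k3, N₄]
    congr! <;> nlinarith
  · have h3 : √3 ^ 2 = 3 := Real.sq_sqrt (by norm_num)
    obtain ⟨α, rfl⟩ : ∃ α, a = α * √3 := ⟨a / √3, by field_simp⟩
    obtain ⟨γ, rfl⟩ : ∃ γ, g = γ * √3 := ⟨g / √3, by field_simp⟩
    have hα : α ^ 2 = 1 := by linear_combination (ha - α ^ 2 * h3) / 3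
    have hγ : γ ^ 2 = 1 := by linear_combination (hg - γ ^ 2 * h3) / 3
    have hαd : (α * d / 2) ^ 2 = 1 := by linear_combination (d ^ 2 * hα + hd) / 4
    obtain ⟨k1, k2, k3⟩ := key α (α * d / 2) (α * d / 2 * γ) hα hαd
      (by linear_combination γ ^ 2 * hαd + hγ)
    have e1 : α * (α * √3) = √3 := by linear_combination √3 * hα
    have e2 : α * (α * d / 2) * d = 2 := by linear_combination d ^ 2 / 2 * hα + hd / 2
    have e3 : α * d / 2 * (α * d / 2 * γ) * (γ * √3) = √3 := by
      linear_combination √3 * (γ ^ 2 * hαd + hγ)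
    refine ⟨_, k1, k2, .inr (.inr (.inr (.inr (.inl ?_))))⟩
    rw [k3, N₅, e1, e2, e3]
    simp
  · obtain ⟨k1, k2, k3⟩ := key 1 d (c / 3) (by norm_num) hd (by linarith)
    refine ⟨_, k1, k2, .inr (.inr (.inr (.inr (.inr ?_))))⟩
    rw [k3, N₆]
    congr! <;> linarith

lemma mulVec_conj {K O : Matrix (Fin 5) (Fin 5) ℝ} (hO : O * Oᵀ = 1) (x : Fin 5 → ℝ) :
    (O * K * Oᵀ) *ᵥ (O *ᵥ x) = O *ᵥ (K *ᵥ x) := by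
  rw [Matrix.mulVec_mulVec, Matrix.mulVec_mulVec, Matrix.mul_assoc (O * K),
    mul_eq_one_comm.1 hO, Matrix.mul_one]

lemma dotProduct_conj {O : Matrix (Fin 5) (Fin 5) ℝ} (hO : O * Oᵀ = 1) (x y : Fin 5 → ℝ) :
    (O *ᵥ x) ⬝ᵥ (O *ᵥ y) = x ⬝ᵥ y := by
  rw [Matrix.dotProduct_mulVec, ← Matrix.mulVec_transpose, Matrix.mulVec_mulVec,
    mul_eq_one_comm.1 hO, Matrix.one_mulVec]

lemma mulVec_eq_zero_of_orthogonal {O : Matrix (Fin 5) (Fin 5) ℝ} (hO : O * Oᵀ = 1)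
    {x : Fin 5 → ℝ} (h : O *ᵥ x = 0) : x = 0 := by
  have := congrArg (Oᵀ *ᵥ ·) h
  simpa [Matrix.mulVec_mulVec, mul_eq_one_comm.1 hO] using this

lemma conj_isSymm {K O : Matrix (Fin 5) (Fin 5) ℝ} (hK : K.IsSymm) : (O * K * Oᵀ).IsSymm := by
  simp [Matrix.IsSymm, Matrix.transpose_mul, hK.eq, Matrix.mul_assoc]

lemma exists_eq_of_isSymm {K : Matrix (Fin 5) (Fin 5) ℝ} (hK : K.IsSymm) :
    K = !![K 0 0, K 0 1, K 0 2, K 0 3, K 0 4; K 0 1, K 1 1, K 1 2, K 1 3, K 1 4;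
      K 0 2, K 1 2, K 2 2, K 2 3, K 2 4; K 0 3, K 1 3, K 2 3, K 3 3, K 3 4;
      K 0 4, K 1 4, K 2 4, K 3 4, K 4 4] := by
  ext i j
  fin_cases i <;> fin_cases j <;> first | rfl | exact hK.apply _ _

/-- The form of a pair in a basis adapted to a two-dimensional common isotropic subspace. -/
lemma exists_conj_rank_two {D B : Matrix (Fin 5) (Fin 5) ℝ} (hD : D.IsSymm) (hB : B.IsSymm)
    {e w : Fin 5 → ℝ} {μ : ℝ} (hDe : D *ᵥ e = 0) (hBe : B *ᵥ e = -(D *ᵥ w))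
    (hBw : B *ᵥ w = -(μ • (D *ᵥ w))) (hww : w ⬝ᵥ (D *ᵥ w) = 0)
    (he : e ≠ 0) (hDw : D *ᵥ w ≠ 0) :
    ∃ O : Matrix (Fin 5) (Fin 5) ℝ, O * Oᵀ = 1 ∧ ∃ a t0 h0 k0 s0 m0 r0 d p t1 h1 k1 s1 m1 r1 : ℝ,
      a ≠ 0 ∧
      O * D * Oᵀ = !![0, 0, 0, 0, 0; 0, 0, a, 0, 0; 0, a, t0, h0, k0; 0, 0, h0, s0, m0;
        0, 0, k0, m0, r0] ∧
      O * B * Oᵀ = !![0, 0, d, 0, 0; 0, 0, p, 0, 0; d, p, t1, h1, k1; 0, 0, h1, s1, m1;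
        0, 0, k1, m1, r1] := by
  obtain ⟨O, hO, hf⟩ := exists_orthogonal_triangular ![e, w, D *ᵥ w, 0, 0]
  refine ⟨O, hO, ?_⟩
  have g0 := mulVec_conj (K := D) hO e
  have g1 := mulVec_conj (K := D) hO w
  have g2 := mulVec_conj (K := B) hO e
  have g3 := mulVec_conj (K := B) hO w
  have g4 := dotProduct_conj hO w (D *ᵥ w)
  rw [hDe, Matrix.mulVec_zero] at g0
  rw [hBe, Matrix.mulVec_neg] at g2
  rw [hBw, Matrix.mulVec_neg, Matrix.mulVec_smul] at g3
  rw [hww] at g4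
  have he' : O *ᵥ e ≠ 0 := fun h => he (mulVec_eq_zero_of_orthogonal hO h)
  have hDw' : O *ᵥ (D *ᵥ w) ≠ 0 := fun h => hDw (mulVec_eq_zero_of_orthogonal hO h)
  have ye : O *ᵥ e = ![(O *ᵥ e) 0, 0, 0, 0, 0] := by
    ext i
    fin_cases i
    · rfl
    all_goals exact hf 0 _ (by decide)
  have yw : O *ᵥ w = ![(O *ᵥ w) 0, (O *ᵥ w) 1, 0, 0, 0] := by
    ext i
    fin_cases i
    · rfl
    · rfl
    all_goals exact hf 1 _ (by decide)
  have yD : O *ᵥ (D *ᵥ w) = ![(O *ᵥ (D *ᵥ w)) 0, (O *ᵥ (D *ᵥ w)) 1, (O *ᵥ (D *ᵥ w)) 2, 0, 0] := by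
    ext i
    fin_cases i
    · rfl
    · rfl
    · rfl
    all_goals exact hf 2 _ (by decide)
  generalize O *ᵥ (D *ᵥ w) = v at *
  generalize O *ᵥ e = e' at *
  generalize O *ᵥ w = w' at *
  have s0 := exists_eq_of_isSymm (conj_isSymm (O := O) hD)
  have s1 := exists_eq_of_isSymm (conj_isSymm (O := O) hB)
  generalize O * D * Oᵀ = K0 at *
  generalize O * B * Oᵀ = K1 at *
  generalize e' 0 = α at *
  generalize w' 0 = β at *
  generalize w' 1 = γ at *
  subst ye yw
  have hα : α ≠ 0 := by
    rintro rfl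
    exact he' (by ext i; fin_cases i <;> rfl)
  rw [s0] at g0 g1
  rw [s1] at g2 g3
  rw [yD] at g1 g2 g3 g4
  have g0' := fun i => congrFun g0 i
  have g1' := fun i => congrFun g1 i
  have g2' := fun i => congrFun g2 i
  have g3' := fun i => congrFun g3 i
  simp [Fin.forall_fin_succ, Matrix.mulVec, dotProduct, Fin.sum_univ_succ, hα] at g0' g1' g2' g3' g4
  obtain ⟨k00, k01, k02, k03, k04⟩ := g0'
  simp [k00, k01, k02, k03, k04] at g1'
  obtain ⟨v0, k11, k12, k13, k14⟩ := g1'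
  rw [← v0] at yD g2' g3' g4
  have hγ : γ ≠ 0 := by
    rintro rfl
    rw [mul_zero] at k11 k12
    exact hDw' (by rw [yD, ← k11, ← k12]; ext i; fin_cases i <;> rfl)
  have v1 : v 1 = 0 := by simpa [hγ] using g4
  rw [v1] at k11 yD g2' g3'
  simp only [hγ, or_false, mul_eq_zero] at k11 k13 k14
  simp [hα] at g2'
  obtain ⟨l00, l01, l02, l03, l04⟩ := g2'
  simp [l00, l01, l03, l04, hγ] at g3'
  obtain ⟨l11, -, l13, l14⟩ := g3'
  rw [k00, k01, k02, k03, k04, k11, k13, k14] at s0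
  rw [l00, l01, l03, l04, l11, l13, l14] at s1
  refine ⟨_, _, _, _, _, _, _, _, _, _, _, _, _, _, _, ?_, s0, s1⟩
  intro h
  rw [h, zero_mul] at k12
  exact hDw' (by rw [yD, ← k12]; ext i; fin_cases i <;> rfl)

/-- The form of a pair in a basis adapted to a three-dimensional common isotropic subspace. -/
lemma exists_conj_rank_three {D B : Matrix (Fin 5) (Fin 5) ℝ} (hD : D.IsSymm) (hB : B.IsSymm)
    {e w u : Fin 5 → ℝ} (hDe : D *ᵥ e = 0) (hBe : B *ᵥ e = -(D *ᵥ w))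
    (hBw : B *ᵥ w = -(D *ᵥ u)) (hww : w ⬝ᵥ (D *ᵥ w) = 0) (hwBw : w ⬝ᵥ (B *ᵥ w) = 0)
    (huu : u ⬝ᵥ (D *ᵥ u) = 0) (huBu : u ⬝ᵥ (B *ᵥ u) = 0)
    (he : e ≠ 0) (hDw : D *ᵥ w ≠ 0) (hDu : ∀ μ : ℝ, D *ᵥ u ≠ μ • (D *ᵥ w)) :
    ∃ O : Matrix (Fin 5) (Fin 5) ℝ, O * Oᵀ = 1 ∧ ∃ a b c s0 m0 r0 d p q m n s1 m1 r1 : ℝ,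
      d ≠ 0 ∧
      O * D * Oᵀ = !![0, 0, 0, 0, 0; 0, 0, 0, a, 0; 0, 0, 0, b, c; 0, a, b, s0, m0;
        0, 0, c, m0, r0] ∧
      O * B * Oᵀ = !![0, 0, 0, d, 0; 0, 0, 0, p, q; 0, 0, 0, m, n; d, p, m, s1, m1;
        0, q, n, m1, r1] := by
  obtain ⟨O, hO, hf⟩ := exists_orthogonal_triangular ![e, w, u, D *ᵥ w, 0]
  refine ⟨O, hO, ?_⟩
  have g0 := mulVec_conj (K := D) hO e
  have g1 := mulVec_conj (K := D) hO w
  have g2 := mulVec_conj (K := B) hO e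
  have g3 := mulVec_conj (K := B) hO w
  have g4 := dotProduct_conj hO w (D *ᵥ w)
  have g5 := mulVec_conj (K := D) hO u
  have g6 := dotProduct_conj hO w (B *ᵥ w)
  have g7 := dotProduct_conj hO u (D *ᵥ u)
  have g8 := dotProduct_conj hO u (B *ᵥ u)
  rw [← mulVec_conj hO] at g6 g7 g8
  rw [hDe, Matrix.mulVec_zero] at g0
  rw [hBe, Matrix.mulVec_neg] at g2
  rw [hBw, Matrix.mulVec_neg] at g3
  rw [hww] at g4
  rw [hwBw] at g6
  rw [huu] at g7
  rw [huBu] at g8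
  have he' : O *ᵥ e ≠ 0 := fun h => he (mulVec_eq_zero_of_orthogonal hO h)
  have hDw' : O *ᵥ (D *ᵥ w) ≠ 0 := fun h => hDw (mulVec_eq_zero_of_orthogonal hO h)
  have hDu' (μ : ℝ) : O *ᵥ (D *ᵥ u) ≠ μ • (O *ᵥ (D *ᵥ w)) := fun h => hDu μ <| by
    rw [← Matrix.mulVec_smul] at h
    simpa [Matrix.mulVec_mulVec, ← Matrix.mul_assoc, mul_eq_one_comm.1 hO] using
      congrArg (Oᵀ *ᵥ ·) h
  have ye : O *ᵥ e = ![(O *ᵥ e) 0, 0, 0, 0, 0] := by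
    ext i
    fin_cases i
    · rfl
    all_goals exact hf 0 _ (by decide)
  have yw : O *ᵥ w = ![(O *ᵥ w) 0, (O *ᵥ w) 1, 0, 0, 0] := by
    ext i
    fin_cases i
    · rfl
    · rfl
    all_goals exact hf 1 _ (by decide)
  have yu : O *ᵥ u = ![(O *ᵥ u) 0, (O *ᵥ u) 1, (O *ᵥ u) 2, 0, 0] := by
    ext i
    fin_cases i
    · rfl
    · rfl
    · rfl
    all_goals exact hf 2 _ (by decide)
  have yD : (O *ᵥ (D *ᵥ w)) 4 = 0 := hf 3 4 (by decide)
  generalize O *ᵥ (D *ᵥ w) = v at *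
  generalize O *ᵥ (D *ᵥ u) = v' at *
  generalize O *ᵥ e = e' at *
  generalize O *ᵥ w = w' at *
  generalize O *ᵥ u = u' at *
  have s0 := exists_eq_of_isSymm (conj_isSymm (O := O) hD)
  have s1 := exists_eq_of_isSymm (conj_isSymm (O := O) hB)
  generalize O * D * Oᵀ = K0 at *
  generalize O * B * Oᵀ = K1 at *
  generalize e' 0 = α at *
  generalize w' 0 = β at *
  generalize w' 1 = γ at *
  generalize u' 0 = δ at *
  generalize u' 1 = ε at *
  generalize u' 2 = ζ at *
  subst ye yw yu
  have hα : α ≠ 0 := by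
    rintro rfl
    exact he' (by ext i; fin_cases i <;> rfl)
  rw [s0] at g0 g1 g5 g7
  rw [s1] at g2 g3 g6 g8
  have g0' := fun i => congrFun g0 i
  have g1' := fun i => congrFun g1 i
  have g2' := fun i => congrFun g2 i
  have g3' := fun i => congrFun g3 i
  have g5' := fun i => congrFun g5 i
  simp [Fin.forall_fin_succ, Matrix.mulVec, dotProduct, Fin.sum_univ_succ, hα]
    at g0' g1' g2' g3' g4 g5' g6 g7 g8
  obtain ⟨k00, k01, k02, k03, k04⟩ := g0'
  simp [k00, k01, k02, k03, k04] at g1' g5' g7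
  obtain ⟨v0, k11, k12, k13, k14⟩ := g1'
  obtain ⟨v0', k21, k22, k23, k24⟩ := g5'
  have hγ : γ ≠ 0 := by
    rintro rfl
    simp only [mul_zero] at k11 k12 k13 k14
    refine hDw' (funext fun i => ?_)
    fin_cases i
    exacts [v0.symm, k11.symm, k12.symm, k13.symm, yD]
  have hζ : ζ ≠ 0 := by
    rintro rfl
    refine hDu' (ε / γ) ?_
    ext i
    fin_cases i <;> simp [← v0, ← v0', ← k11, ← k12, ← k13, ← k14, ← k21, ← k22, ← k23, ← k24] <;>
      field_simp
  have v1 : v 1 = 0 := by simpa [hγ, ← v0] using g4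
  rw [yD] at k14 g2'
  rw [v1] at k11 g2'
  rw [← v0] at g2'
  simp only [hγ, or_false, mul_eq_zero] at k11 k14
  simp [hα] at g2'
  obtain ⟨l00, l01, l02, l03, l04⟩ := g2'
  simp [l00, l01, l04, hγ, ← v0'] at g3' g6
  simp [g6] at g3'
  have v1' : v' 1 = 0 := by simpa using g3'.1
  rw [v1', k11, zero_mul, zero_add] at k21
  simp only [hζ, or_false, mul_eq_zero] at k21
  simp [k21] at k12
  simp [k11, k21, hζ] at g7
  simp [k21, g7] at k22
  simp [← k12, hα] at l02
  simp [l02, ← k22, hγ] at g3'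
  obtain ⟨-, l12, l13, l14⟩ := g3'
  simp [l00, l01, l02, g6, l12, hζ] at g8
  rw [k00, k01, k02, k03, k04, k11, k21, g7, k14] at s0
  rw [l00, l01, l02, l04, g6, l12, g8] at s1
  refine ⟨_, _, _, _, _, _, _, _, _, _, _, _, _, _, ?_, s0, s1⟩
  intro h
  rw [h, zero_mul, eq_comm, neg_eq_zero] at l03
  refine hDw' (funext fun i => ?_)
  fin_cases i
  exacts [v0.symm, v1, k12.symm, l03, yD]

lemma rank_three_solve {ℓ g b c s0 t0 s1 t1 : ℝ} (hℓ0 : 0 < ℓ) (hℓ1 : ℓ < 1)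
    (hgc : ℓ * g ^ 2 * c ^ 2 = 9)
    (hxx : s0 ^ 2 + t0 ^ 2 + ℓ * g ^ 2 + b ^ 2 + c ^ 2 = 10)
    (hyy : s1 ^ 2 + t1 ^ 2 + g ^ 2 + ℓ * (b ^ 2 + c ^ 2) = 10)
    (hxy : s0 * s1 + t0 * t1 + b * g * (1 - ℓ) = 0)
    (h0 : s0 * (ℓ * g ^ 2 + b ^ 2 - c ^ 2) + 2 * t0 * b * c = 0)
    (h1 : s1 * (ℓ * g ^ 2 + b ^ 2 - c ^ 2) + 2 * t1 * b * c
      + 2 * (1 - ℓ) * g * (s0 * b + t0 * c) = 0)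
    (h2 : s0 * (g ^ 2 + ℓ * (b ^ 2 - c ^ 2)) + 2 * t0 * ℓ * b * c
      + 2 * (1 - ℓ) * g * (s1 * b + t1 * c) = 0)
    (h3 : s1 * (g ^ 2 + ℓ * (b ^ 2 - c ^ 2)) + 2 * t1 * ℓ * b * c = 0) :
    b = 0 ∧ s0 = 0 ∧ t0 = 0 ∧ s1 = 0 ∧ t1 = 0 ∧ c ^ 2 = 9 ∧ g ^ 2 = 9 ∧ ℓ = 1 / 9 := by
  have hg : g ≠ 0 := by rintro rfl; norm_num at hgc
  have hc : c ≠ 0 := by rintro rfl; norm_num at hgc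
  have hκ : (1 - ℓ) ≠ 0 := by linarith
  have hℓ : ℓ ≠ 0 := hℓ0.ne'
  have hg2 : 0 < g ^ 2 := by positivity
  have hc2 : 0 < c ^ 2 := by positivity
  have T0 : 2 * ℓ * (s0 * b + t0 * c) = s1 * g * (1 + ℓ) := by
    refine mul_right_cancel₀ (mul_ne_zero hκ hg) ?_
    linear_combination ℓ * h1 - h3
  have T1 : 2 * (s1 * b + t1 * c) = -(s0 * g * (1 + ℓ)) := by
    refine mul_right_cancel₀ (mul_ne_zero hκ hg) ?_
    linear_combination h2 - ℓ * h0
  have U0 : ℓ * s0 * (b ^ 2 + c ^ 2 - ℓ * g ^ 2) = b * g * (1 + ℓ) * s1 := by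
    linear_combination b * T0 - ℓ * h0
  have U1 : s1 * (ℓ * (b ^ 2 + c ^ 2) - g ^ 2) = -(ℓ * (b * g * (1 + ℓ)) * s0) := by
    linear_combination ℓ * b * T1 - h3
  by_cases hb : b = 0
  · subst hb
    have V0 : s0 = 0 ∨ c ^ 2 = ℓ * g ^ 2 := by
      have : ℓ * s0 * (c ^ 2 - ℓ * g ^ 2) = 0 := by linear_combination U0
      simpa [hℓ, sub_eq_zero] using this
    have V1 : s1 = 0 ∨ ℓ * c ^ 2 = g ^ 2 := by
      have : s1 * (ℓ * c ^ 2 - g ^ 2) = 0 := by linear_combination U1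
      simpa [sub_eq_zero] using this
    have hsq : (1 - ℓ) ^ 2 ≠ 0 := pow_ne_zero 2 hκ
    have s0z : s0 = 0 := by
      by_contra hs
      have e1 := V0.resolve_left hs
      have s1z : s1 = 0 := by
        by_contra hs1
        have e2 := V1.resolve_left hs1
        have : g ^ 2 * (1 - ℓ) * (1 + ℓ) = 0 := by linear_combination ℓ * e1 - e2
        simp [hg, hκ] at this
        linarith
      subst s1z
      have t0z : t0 = 0 := by
        have : 2 * ℓ * c * t0 = 0 := by linear_combination T0
        simpa [hℓ, hc] using this
      subst t0z
      have c3 : c ^ 2 = 3 := by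
        have : (c ^ 2 - 3) * (c ^ 2 + 3) = 0 := by linear_combination hgc + c ^ 2 * e1
        rcases mul_eq_zero.1 this with h | h <;> linarith
      have s4 : s0 ^ 2 = 4 := by linarith
      have e3 : 4 * t1 ^ 2 * c ^ 2 = s0 ^ 2 * g ^ 2 * (1 + ℓ) ^ 2 := by
        linear_combination (2 * t1 * c - s0 * g * (1 + ℓ)) * T1
      rw [s4, c3] at e3
      apply hsq
      linear_combination (3 * ℓ * hyy - ℓ * e3 / 4 + (3 + (1 + ℓ) ^ 2) * (e1 - c3)
        - 3 * ℓ ^ 2 * c3) / 12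
    have s1z : s1 = 0 := by
      by_contra hs
      have e1 := V1.resolve_left hs
      subst s0z
      have t1z : t1 = 0 := by
        have : 2 * c * t1 = 0 := by linear_combination T1
        simpa [hc] using this
      subst t1z
      have g3 : g ^ 2 = 3 := by
        have : (g ^ 2 - 3) * (g ^ 2 + 3) = 0 := by linear_combination hgc - g ^ 2 * e1
        rcases mul_eq_zero.1 this with h | h <;> linarith
      have s4 : s1 ^ 2 = 4 := by linarith
      have e3 : 4 * ℓ ^ 2 * t0 ^ 2 * c ^ 2 = s1 ^ 2 * g ^ 2 * (1 + ℓ) ^ 2 := by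
        linear_combination (2 * ℓ * t0 * c + s1 * g * (1 + ℓ)) * T0
      rw [s4, g3] at e3
      apply hsq
      linear_combination (ℓ * hxx - ℓ ^ 2 * g3 - (e1 + g3) - e3 / 12 + ℓ * t0 ^ 2 / 3 * (e1
        + g3)) / 4
    subst s0z s1z
    have t1z : t1 = 0 := by
      have : 2 * c * t1 = 0 := by linear_combination T1
      simpa [hc] using this
    have t0z : t0 = 0 := by
      have : 2 * ℓ * c * t0 = 0 := by linear_combination T0
      simpa [hℓ, hc] using this
    subst t0z t1z
    have egc : g ^ 2 = c ^ 2 := by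
      refine mul_right_cancel₀ hκ ?_
      linear_combination hyy - hxx
    rw [egc] at hgc hxx
    have : (c ^ 2 - 1) * (c ^ 2 - 9) = 0 := by linear_combination c ^ 2 * hxx - hgc
    have hc9 : c ^ 2 = 9 := by
      rcases mul_eq_zero.1 this with h | h
      · have : c ^ 2 = 1 := by linarith
        rw [this] at hxx
        linarith
      · linarith
    rw [hc9] at hxx
    exact ⟨rfl, rfl, rfl, rfl, rfl, hc9, egc.trans hc9, by linarith⟩
  · exfalso
    have hk : 0 < 1 + ℓ := by linarith
    have hbg : b * g * (1 + ℓ) ≠ 0 := mul_ne_zero (mul_ne_zero hb hg) hk.ne'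
    have hs0 : s0 ≠ 0 := by
      rintro rfl
      have s1z : s1 = 0 := by
        have : b * g * (1 + ℓ) * s1 = 0 := by linear_combination -U0
        simpa [hbg] using this
      subst s1z
      have t1z : t1 = 0 := by
        have : 2 * c * t1 = 0 := by linear_combination T1
        simpa [hc] using this
      subst t1z
      have : b * g * (1 - ℓ) = 0 := by linear_combination hxy
      simp [hb, hg, hκ] at this
    have hνν : (b ^ 2 + c ^ 2 - ℓ * g ^ 2) * (ℓ * (b ^ 2 + c ^ 2) - g ^ 2) =
        -(b * g * (1 + ℓ)) ^ 2 := by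
      refine mul_left_cancel₀ (mul_ne_zero hℓ hs0) ?_
      linear_combination (ℓ * (b ^ 2 + c ^ 2) - g ^ 2) * U0 + b * g * (1 + ℓ) * U1
    have hν : 0 < b ^ 2 + c ^ 2 - ℓ * g ^ 2 := by
      by_contra! hν
      have : ℓ * (b ^ 2 + c ^ 2) - g ^ 2 ≤ 0 := by nlinarith
      have := mul_nonneg_of_nonpos_of_nonpos hν this
      have := sq_pos_of_ne_zero hbg
      linarith
    have key : s0 ^ 2 * (b ^ 2 + c ^ 2 - ℓ * g ^ 2) * g ^ 2 * (1 - ℓ) ^ 2 +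
        4 * (1 - ℓ) * (1 + ℓ) * b ^ 2 * g ^ 2 * c ^ 2 = 0 := by
      have E : 4 * ℓ * (b ^ 2 + c ^ 2) * s0 * s1 - s0 * s1 * g ^ 2 * (1 + ℓ) ^ 2
          - 2 * s1 ^ 2 * (b * g * (1 + ℓ)) + 2 * ℓ * s0 ^ 2 * (b * g * (1 + ℓ))
          + 4 * ℓ * b * g * (1 - ℓ) * c ^ 2 = 0 := by
        linear_combination 4 * ℓ * c ^ 2 * hxy - 2 * t1 * c * T0
          - (s1 * g * (1 + ℓ) - 2 * ℓ * s0 * b) * T1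
      refine mul_left_cancel₀ hℓ ?_
      linear_combination b * g * (1 + ℓ) * E - 2 * ℓ * s0 ^ 2 * hνν
        + (4 * ℓ * (b ^ 2 + c ^ 2) * s0 - s0 * g ^ 2 * (1 + ℓ) ^ 2
          - 2 * (b * g * (1 + ℓ) * s1 + ℓ * s0 * (b ^ 2 + c ^ 2 - ℓ * g ^ 2))) * U0
    have p1 : 0 < s0 ^ 2 * (b ^ 2 + c ^ 2 - ℓ * g ^ 2) * g ^ 2 * (1 - ℓ) ^ 2 := by positivity
    have h1ℓ : 0 < 1 - ℓ := by linarith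
    have p2 : 0 < 4 * (1 - ℓ) * (1 + ℓ) * b ^ 2 * g ^ 2 * c ^ 2 := by positivity
    linarith

lemma hasNormalForm_rank_three_model {a γ l δ w : ℝ} (ha : a ^ 2 = 1) (hγ : γ ^ 2 = 1)
    (hl : l ^ 2 = 1) (hδ : δ ^ 2 = 1) (hw : w ^ 2 = 1 / 2) :
    HasNormalForm !![0, 0, 0, 0, 0; 0, 0, 0, a, 0; 0, 0, 0, 0, 3 * γ; 0, a, 0, 0, 0;
        0, 0, 3 * γ, 0, 0]
      !![0, 0, 0, 8 / 3 * w * δ, 0; 0, 0, 0, 0, l * γ; 0, 0, 0, 7 / 3 * a * l, 0;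
        8 / 3 * w * δ, 0, 7 / 3 * a * l, 0, 0; 0, l * γ, 0, 0, 0] := by
  refine ⟨!![0, 0, w, 0, w * γ; 0, l * w, 0, l * a * w, 0; l * a * δ, 0, 0, 0, 0;
    0, -(l * w), 0, l * a * w, 0; 0, 0, w, 0, -(w * γ)], ?_, ?_, Or.inl ?_⟩
  all_goals
    ext i j
    fin_cases i <;> fin_cases j <;>
      simp [Matrix.mul_apply, Fin.sum_univ_succ, D5, N₁] <;> grind

lemma coeff_eq_zero_of_forall {c0 c1 c2 c3 c4 : ℝ}
    (h : ∀ z : ℝ, c0 + c1 * z + c2 * z ^ 2 + c3 * z ^ 3 + c4 * z ^ 4 = 0) :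
    c0 = 0 ∧ c1 = 0 ∧ c2 = 0 ∧ c3 = 0 ∧ c4 = 0 := by
  have h0 := h 0
  have h1 := h 1
  have h2 := h (-1)
  have h3 := h 2
  have h4 := h (-2)
  norm_num at h0 h1 h2 h3 h4
  refine ⟨?_, ?_, ?_, ?_, ?_⟩ <;> linarith

lemma CircularPair.rank_three_det {a b c s0 m0 r0 d p q m n s1 m1 r1 : ℝ}
    (h : CircularPair !![0, 0, 0, 0, 0; 0, 0, 0, a, 0; 0, 0, 0, b, c; 0, a, b, s0, m0;
        0, 0, c, m0, r0]
      !![0, 0, 0, d, 0; 0, 0, 0, p, q; 0, 0, 0, m, n; d, p, m, s1, m1; 0, q, n, m1, r1])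
    (x y : ℝ) : (s0 + r0) * x + (s1 + r1) * y = 0 ∧
    (s0 * x + s1 * y) * (r0 * x + r1 * y) - (m0 * x + m1 * y) ^ 2
      - ((d * y) ^ 2 + (a * x + p * y) ^ 2 + (b * x + m * y) ^ 2) - ((q * y) ^ 2 + (c * x
        + n * y) ^ 2)
      + 10 * (x ^ 2 + y ^ 2) = 0 ∧
    (r0 * x + r1 * y) * ((d * y) ^ 2 + (a * x + p * y) ^ 2 + (b * x + m * y) ^ 2)
      + (s0 * x + s1 * y) * ((q * y) ^ 2 + (c * x + n * y) ^ 2)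
      - 2 * (m0 * x + m1 * y) * ((a * x + p * y) * (q * y) + (b * x + m * y) * (c * x
        + n * y)) = 0 ∧
    ((a * x + p * y) * (c * x + n * y) - (b * x + m * y) * (q * y)) ^ 2
      + (d * y * (c * x + n * y)) ^ 2 + (d * y * (q * y)) ^ 2 - 9 * (x ^ 2 + y ^ 2) ^ 2 = 0 := by
  simp [CircularPair, det_fin_five] at h
  obtain ⟨-, e1, e2, e3, e4⟩ := coeff_eq_zero_of_forall (fun z =>
    (by linear_combination h x y z : 0 +
    (((a * x + p * y) * (c * x + n * y) - (b * x + m * y) * (q * y)) ^ 2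
      + (d * y * (c * x + n * y)) ^ 2 + (d * y * (q * y)) ^ 2 - 9 * (x ^ 2 + y ^ 2) ^ 2) * z +
    ((r0 * x + r1 * y) * ((d * y) ^ 2 + (a * x + p * y) ^ 2 + (b * x + m * y) ^ 2)
      + (s0 * x + s1 * y) * ((q * y) ^ 2 + (c * x + n * y) ^ 2)
      - 2 * (m0 * x + m1 * y) * ((a * x + p * y) * (q * y) + (b * x + m * y) * (c * x
        + n * y))) * z ^ 2
    + ((s0 * x + s1 * y) * (r0 * x + r1 * y) - (m0 * x + m1 * y) ^ 2
      - ((d * y) ^ 2 + (a * x + p * y) ^ 2 + (b * x + m * y) ^ 2) - ((q * y) ^ 2 + (c * x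
        + n * y) ^ 2)
      + 10 * (x ^ 2 + y ^ 2)) * z ^ 3 + (-((s0 + r0) * x + (s1 + r1) * y)) * z ^ 4 = 0))
  exact ⟨by linarith, e3, e2, e1⟩

lemma CircularPair.hasNormalForm_of_rank_three {a b c s0 m0 r0 d p q m n s1 m1 r1 : ℝ}
    (h : CircularPair !![0, 0, 0, 0, 0; 0, 0, 0, a, 0; 0, 0, 0, b, c; 0, a, b, s0, m0;
        0, 0, c, m0, r0]
      !![0, 0, 0, d, 0; 0, 0, 0, p, q; 0, 0, 0, m, n; d, p, m, s1, m1; 0, q, n, m1, r1])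
    (hd : d ≠ 0) : HasNormalForm !![0, 0, 0, 0, 0; 0, 0, 0, a, 0; 0, 0, 0, b, c; 0, a, b, s0, m0;
        0, 0, c, m0, r0]
      !![0, 0, 0, d, 0; 0, 0, 0, p, q; 0, 0, 0, m, n; d, p, m, s1, m1; 0, q, n, m1, r1] := by
  have hdet := h.rank_three_det
  clear h
  obtain ⟨f0, f1, -⟩ := coeff_eq_zero_of_forall (c0 := s0 + r0) (c1 := s1 + r1) (c2 := 0)
    (c3 := 0) (c4 := 0) fun y => by linear_combination (hdet 1 y).1
  obtain rfl : r0 = -s0 := by linarith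
  obtain rfl : r1 = -s1 := by linarith
  obtain ⟨q0, q1, q2, q3, q4⟩ := coeff_eq_zero_of_forall fun y =>
    (by linear_combination (hdet 1 y).2.2.2 :
      (a ^ 2 * c ^ 2 - 9) + (2 * (a * c) * (a * n + p * c - b * q)) * y
      + ((a * n + p * c - b * q) ^ 2 + 2 * (a * c) * (p * n - m * q) + d ^ 2 * c ^ 2 - 18) * y ^ 2
      + (2 * (a * n + p * c - b * q) * (p * n - m * q) + 2 * d ^ 2 * c * n) * y ^ 3
      + ((p * n - m * q) ^ 2 + d ^ 2 * n ^ 2 + d ^ 2 * q ^ 2 - 9) * y ^ 4 = 0)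
  have ha : a ≠ 0 := by rintro rfl; norm_num at q0
  have hc : c ≠ 0 := by rintro rfl; norm_num at q0
  have he : a * n + p * c - b * q = 0 := by simpa [ha, hc] using q1
  rw [he] at q2 q3
  obtain rfl : n = 0 := by simpa [hd, hc] using q3
  have hq : q ≠ 0 := by rintro rfl; norm_num at q4
  obtain ⟨v, rfl⟩ : ∃ v, q = v * c := ⟨q / c, by field_simp⟩
  have hv : v ≠ 0 := left_ne_zero_of_mul hq
  obtain ⟨g, rfl⟩ : ∃ g, a = v * g := ⟨a / v, by field_simp⟩
  have hg : g ≠ 0 := right_ne_zero_of_mul ha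
  obtain rfl : p = v * b := mul_right_cancel₀ hc (by linear_combination he)
  have d2 : d ^ 2 = 2 * v ^ 2 * g ^ 2 + 2 * v ^ 2 * g * m :=
    mul_right_cancel₀ (pow_ne_zero 2 hc) (by linear_combination q2 - 2 * q0)
  have d3 : m ^ 2 + d ^ 2 = g ^ 2 :=
    mul_right_cancel₀ (mul_ne_zero (pow_ne_zero 2 hc) (pow_ne_zero 2 hv))
      (by linear_combination q4 - q0)
  have hmg : m + g ≠ 0 := by
    intro h0
    apply hd
    refine pow_eq_zero_iff (two_ne_zero) |>.1 ?_
    linear_combination d2 + 2 * v ^ 2 * g * h0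
  obtain rfl : m = g * (1 - 2 * v ^ 2) :=
    mul_left_cancel₀ hmg (by linear_combination d3 - d2)
  have hv1 : v ^ 2 < 1 := by
    have : 0 < 4 * v ^ 2 * g ^ 2 * (1 - v ^ 2) := by
      have : 0 < d ^ 2 := by positivity
      linarith
    have := pos_of_mul_pos_right this (by positivity)
    linarith
  obtain ⟨a0, a1, a2, -⟩ := coeff_eq_zero_of_forall (c3 := 0) (c4 := 0) fun y =>
    (by linear_combination (hdet 1 y).2.1 + y ^ 2 * d2 :
      (10 - (s0 ^ 2 + m0 ^ 2 + v ^ 2 * g ^ 2 + b ^ 2 + c ^ 2))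
      + (-2 * (s0 * s1 + m0 * m1 + b * g * (1 - v ^ 2))) * y
      + (10 - (s1 ^ 2 + m1 ^ 2 + g ^ 2 + v ^ 2 * (b ^ 2 + c ^ 2))) * y ^ 2
      + 0 * y ^ 3 + 0 * y ^ 4 = 0)
  obtain ⟨b0, b1, b2, b3, -⟩ := coeff_eq_zero_of_forall (c4 := 0) fun y =>
    (by linear_combination -(hdet 1 y).2.2.1 - y ^ 2 * (s0 + s1 * y) * d2 :
      (s0 * (v ^ 2 * g ^ 2 + b ^ 2 - c ^ 2) + 2 * m0 * b * c)
      + (s1 * (v ^ 2 * g ^ 2 + b ^ 2 - c ^ 2) + 2 * m1 * b * c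
        + 2 * (1 - v ^ 2) * g * (s0 * b + m0 * c)) * y
      + (s0 * (g ^ 2 + v ^ 2 * (b ^ 2 - c ^ 2)) + 2 * m0 * v ^ 2 * b * c
      + 2 * (1 - v ^ 2) * g * (s1 * b + m1 * c)) * y ^ 2
      + (s1 * (g ^ 2 + v ^ 2 * (b ^ 2 - c ^ 2)) + 2 * m1 * v ^ 2 * b * c) * y ^ 3
      + 0 * y ^ 4 = 0)
  obtain ⟨rfl, rfl, rfl, rfl, rfl, c9, g9, hv9⟩ := rank_three_solve (by positivity) hv1
    (by linear_combination q0) (by linarith) (by linarith) (by linarith) b0 b1 b2 b3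
  have h2 : √2 ^ 2 = 2 := Real.sq_sqrt (by norm_num)
  have key := hasNormalForm_rank_three_model (a := v * g) (γ := c / 3) (l := 3 * v)
    (δ := 3 * √2 / 8 * d) (w := √2 / 2) (by rw [mul_pow, hv9, g9]; norm_num)
    (by rw [div_pow, c9]; norm_num) (by rw [mul_pow, hv9]; norm_num)
    (by rw [mul_pow, div_pow, mul_pow, h2, d2]; linear_combination (9 / 8) * v ^ 2 * (1
      - v ^ 2) * g9 + (81 / 8 * (8 / 9 - v ^ 2)) * hv9)
    (by rw [div_pow, h2]; norm_num)
  have e1 : 3 * (c / 3) = c := by ring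
  have e2 : 8 / 3 * (√2 / 2) * (3 * √2 / 8 * d) = d := by linear_combination d / 2 * h2
  have e3 : 3 * v * (c / 3) = v * c := by ring
  have e4 : 7 / 3 * (v * g) * (3 * v) = g * (1 - 2 * v ^ 2) := by linear_combination 9 * g * hv9
  rw [e1, e2, e3, e4] at key
  simpa using key

set_option maxHeartbeats 1000000 in
lemma hasNormalForm_rank_two_model_one {a σ ε c e : ℝ} (ha : a ^ 2 = 1) (hσ : σ ^ 2 = 1)
    (hε : ε ^ 2 = 1) (hc : c ^ 2 + e ^ 2 = 1) :
    HasNormalForm !![0, 0, 0, 0, 0; 0, 0, a, 0, 0; 0, a, 0, 0, 0;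
        0, 0, 0, 3 * (c ^ 2 - e ^ 2), 3 * (2 * c * e);
        0, 0, 0, 3 * (2 * c * e), -(3 * (c ^ 2 - e ^ 2))]
      !![0, 0, σ * a, 0, 0; 0, 0, 0, 0, 0; σ * a, 0, 0, 0, 0;
        0, 0, 0, -(ε * (3 * (2 * c * e))), ε * (3 * (c ^ 2 - e ^ 2));
        0, 0, 0, ε * (3 * (c ^ 2 - e ^ 2)), ε * (3 * (2 * c * e))] := by
  have h2 : √2 ^ 2 = 2 := Real.sq_sqrt (by norm_num)
  refine ⟨!![0, 0, 0, c, e; 0, √2 / 2, a * (√2 / 2), 0, 0; σ, 0, 0, 0, 0;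
    0, -(√2 / 2), a * (√2 / 2), 0, 0; 0, 0, 0, -(ε * e), ε * c], ?_, ?_, Or.inr (Or.inl ?_)⟩
  all_goals
    ext i j
    fin_cases i <;> fin_cases j <;>
      simp [Matrix.mul_apply, Fin.sum_univ_succ, D5, N₂] <;> grind

set_option maxHeartbeats 1000000 in
lemma hasNormalForm_rank_two_model_three {a σ ε c e : ℝ} (ha : a ^ 2 = 9) (hσ : σ ^ 2 = 1)
    (hε : ε ^ 2 = 1) (hc : c ^ 2 + e ^ 2 = 1) :
    HasNormalForm !![0, 0, 0, 0, 0; 0, 0, a, 0, 0; 0, a, 0, 0, 0;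
        0, 0, 0, c ^ 2 - e ^ 2, 2 * c * e; 0, 0, 0, 2 * c * e, -(c ^ 2 - e ^ 2)]
      !![0, 0, σ * a, 0, 0; 0, 0, 0, 0, 0; σ * a, 0, 0, 0, 0;
        0, 0, 0, -(ε * (2 * c * e)), ε * (c ^ 2 - e ^ 2);
        0, 0, 0, ε * (c ^ 2 - e ^ 2), ε * (2 * c * e)] := by
  have h2 : √2 ^ 2 = 2 := Real.sq_sqrt (by norm_num)
  refine ⟨!![0, √2 / 2, a / 3 * (√2 / 2), 0, 0; 0, 0, 0, c, e; σ, 0, 0, 0, 0;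
    0, 0, 0, -(ε * e), ε * c; 0, -(√2 / 2), a / 3 * (√2 / 2), 0, 0], ?_, ?_,
    Or.inr (Or.inr (Or.inl ?_))⟩
  all_goals
    ext i j
    fin_cases i <;> fin_cases j <;>
      simp [Matrix.mul_apply, Fin.sum_univ_succ, D5, N₃] <;> grind

lemma exists_half_angle {s t : ℝ} (h : s ^ 2 + t ^ 2 = 1) :
    ∃ c e : ℝ, c ^ 2 + e ^ 2 = 1 ∧ s = c ^ 2 - e ^ 2 ∧ t = 2 * c * e := by
  obtain ⟨w, hw⟩ := IsAlgClosed.exists_pow_nat_eq (⟨s, t⟩ : ℂ) (n := 2) two_pos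
  have hre := congrArg Complex.re hw
  have him := congrArg Complex.im hw
  simp [pow_two] at hre him
  refine ⟨w.re, w.im, ?_, by linarith, by linarith⟩
  have : (w.re ^ 2 + w.im ^ 2) ^ 2 = 1 := by
    rw [← h, ← hre, ← him]
    ring
  nlinarith [sq_nonneg w.re, sq_nonneg w.im]

open ComplexConjugate in
lemma rank_two_fourier {τ α β γ η M κ ρ : ℂ} (h1 : α * β = -τ ^ 2)
    (h2 : α * conj α + β * conj β + 2 * (τ * conj τ) = M) (h3 : γ * η = τ ^ 2 / 4)
    (h4 : γ * conj γ + η * conj η = τ * conj τ / 2 + ρ)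
    (h5 : γ * α ^ 2 + η * β ^ 2 = τ ^ 3)
    (h6 : 2 * γ * α * conj β + conj η * α ^ 2 + 2 * η * β * conj α + conj γ * β ^ 2 =
      -M * τ + 3 * τ ^ 2 * conj τ - 2 * (κ - ρ) * τ) (hκ : κ ≠ 0) (hρ : ρ ≠ 0) :
    τ = 0 ∧ α = 0 ∧ β = 0 := by
  have hτ : τ = 0 := by
    by_contra hτ
    have hτ' : conj τ ≠ 0 := by simpa using hτ
    have hd : γ * α ^ 2 - η * β ^ 2 = 0 := by
      refine pow_eq_zero_iff two_ne_zero |>.1 ?_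
      linear_combination (γ * α ^ 2 + η * β ^ 2 + τ ^ 3) * h5 - 4 * α ^ 2 * β ^ 2 * h3
        - τ ^ 2 * (α * β - τ ^ 2) * h1
    have e1 : 2 * γ * τ = β ^ 2 := mul_left_cancel₀ (pow_ne_zero 3 hτ) (by
      linear_combination β ^ 2 * (h5 + hd) - 2 * γ * (α * β - τ ^ 2) * h1)
    have e2 : 2 * η * τ = α ^ 2 := mul_left_cancel₀ (pow_ne_zero 3 hτ) (by
      linear_combination α ^ 2 * (h5 - hd) - 2 * η * (α * β - τ ^ 2) * h1)
    have e1' := congrArg conj e1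
    have e2' := congrArg conj e2
    simp only [map_mul, map_pow, Complex.conj_ofNat] at e1' e2'
    have : κ * (τ ^ 2 * conj τ) = 0 := by
      linear_combination (2 * τ * conj τ * h6 - 2 * α * conj τ * conj β * e1 - τ * α ^ 2 * e2'
        - 2 * β * conj τ * conj α * e2 - τ * β ^ 2 * e1'
        - 2 * conj τ * (α * conj α + β * conj β) * h1 + 2 * τ ^ 2 * conj τ * h2
        - 4 * τ ^ 2 * conj τ * h4 + τ * (2 * conj η * conj τ * e2 + α ^ 2 * e2'
          + 2 * conj γ * conj τ * e1 + β ^ 2 * e1')) / 4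
    exact mul_ne_zero hκ (mul_ne_zero (pow_ne_zero 2 hτ) hτ') this
  subst hτ
  simp only [map_zero] at h2 h4 h5 h6
  rcases mul_eq_zero.1 (h1.trans (by ring)) with rfl | rfl
  · refine ⟨rfl, rfl, ?_⟩
    by_contra hβ
    have e1 : η = 0 := by simpa [hβ] using h5
    have e2 : γ = 0 := by simpa [hβ] using h6
    apply hρ
    simpa [e1, e2] using h4.symm
  · refine ⟨rfl, ?_, rfl⟩
    by_contra hβ
    have e1 : γ = 0 := by simpa [hβ] using h5
    have e2 : η = 0 := by simpa [hβ] using h6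
    apply hρ
    simpa [e1, e2] using h4.symm

lemma CircularPair.rank_two_det {a t0 h0 k0 s0 m0 r0 d p t1 h1 k1 s1 m1 r1 : ℝ}
    (h : CircularPair !![0, 0, 0, 0, 0; 0, 0, a, 0, 0; 0, a, t0, h0, k0; 0, 0, h0, s0, m0;
        0, 0, k0, m0, r0]
      !![0, 0, d, 0, 0; 0, 0, p, 0, 0; d, p, t1, h1, k1; 0, 0, h1, s1, m1; 0, 0, k1, m1, r1])
    (x y : ℝ) : ∀ t h k s m r q : ℝ, t = t0 * x + t1 * y → h = h0 * x + h1 * y →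
      k = k0 * x + k1 * y → s = s0 * x + s1 * y → m = m0 * x + m1 * y → r = r0 * x + r1 * y →
      q = d ^ 2 * y ^ 2 + (a * x + p * y) ^ 2 →
    t + s + r = 0 ∧
    t * s + t * r + s * r - h ^ 2 - k ^ 2 - m ^ 2 - q + 10 * (x ^ 2 + y ^ 2) = 0 ∧
    q * (s + r) - (t * (s * r - m ^ 2) - h ^ 2 * r + 2 * h * k * m - k ^ 2 * s) = 0 ∧
    q * (s * r - m ^ 2) + 9 * (x ^ 2 + y ^ 2) ^ 2 = 0 := by
  simp [CircularPair, det_fin_five] at h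
  rintro _ _ _ _ _ _ _ rfl rfl rfl rfl rfl rfl rfl
  obtain ⟨-, e1, e2, e3, e4⟩ := coeff_eq_zero_of_forall (fun z =>
    (by linear_combination h x y z : 0 +
    (-((d ^ 2 * y ^ 2 + (a * x + p * y) ^ 2) * ((s0 * x + s1 * y) * (r0 * x + r1 * y)
      - (m0 * x + m1 * y) ^ 2) + 9 * (x ^ 2 + y ^ 2) ^ 2)) * z +
    ((d ^ 2 * y ^ 2 + (a * x + p * y) ^ 2) * ((s0 * x + s1 * y) + (r0 * x + r1 * y))
      - ((t0 * x + t1 * y) * ((s0 * x + s1 * y) * (r0 * x + r1 * y) - (m0 * x + m1 * y) ^ 2)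
        - (h0 * x + h1 * y) ^ 2 * (r0 * x + r1 * y)
        + 2 * (h0 * x + h1 * y) * (k0 * x + k1 * y) * (m0 * x + m1 * y)
        - (k0 * x + k1 * y) ^ 2 * (s0 * x + s1 * y))) * z ^ 2
    + ((t0 * x + t1 * y) * (s0 * x + s1 * y) + (t0 * x + t1 * y) * (r0 * x + r1 * y)
      + (s0 * x + s1 * y) * (r0 * x + r1 * y) - (h0 * x + h1 * y) ^ 2 - (k0 * x + k1 * y) ^ 2
      - (m0 * x + m1 * y) ^ 2 - (d ^ 2 * y ^ 2 + (a * x + p * y) ^ 2)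
      + 10 * (x ^ 2 + y ^ 2)) * z ^ 3
    + (-((t0 * x + t1 * y) + (s0 * x + s1 * y) + (r0 * x + r1 * y))) * z ^ 4 = 0))
  exact ⟨by linarith, e3, e2, by linarith⟩

lemma binary_quadratic_factor {a d p A B C : ℝ} (ha : a ≠ 0)
    (h : ∀ x y : ℝ, (d ^ 2 * y ^ 2 + (a * x + p * y) ^ 2) * (A * x ^ 2 + B * (x * y) + C * y ^ 2)
      + 9 * (x ^ 2 + y ^ 2) ^ 2 = 0) :
    p = 0 ∧ d ^ 2 = a ^ 2 ∧ a ^ 2 * A = -9 ∧ B = 0 ∧ a ^ 2 * C = -9 := by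
  obtain ⟨q0, q1, q2, q3, q4⟩ := coeff_eq_zero_of_forall fun y =>
    (by linear_combination h 1 y :
      (a ^ 2 * A + 9) + (a * (a * B + 2 * p * A)) * y
      + (a ^ 2 * C + 2 * a * p * B + (d ^ 2 + p ^ 2) * A + 18) * y ^ 2
      + (2 * a * p * C + (d ^ 2 + p ^ 2) * B) * y ^ 3
      + ((d ^ 2 + p ^ 2) * C + 9) * y ^ 4 = 0)
  have ha2 : 0 < a ^ 2 := by positivity
  have e1 : a * B + 2 * p * A = 0 := by simpa [ha] using q1
  have hp : p = 0 := by
    by_contra hp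
    have e2 : p * (a ^ 2 * a ^ 2 * C - (d ^ 2 + p ^ 2) * a ^ 2 * A) = 0 := by
      linear_combination a ^ 3 / 2 * q3 - (d ^ 2 + p ^ 2) * a ^ 2 / 2 * e1
    have e3 : (d ^ 2 + p ^ 2 - a ^ 2) * (d ^ 2 + p ^ 2 + a ^ 2) = 0 := by
      have := (mul_eq_zero.1 e2).resolve_left hp
      linear_combination (1 / 9) * (d ^ 2 + p ^ 2) * this - a ^ 4 / 9 * q4
        + (d ^ 2 + p ^ 2) ^ 2 / 9 * q0
    have e4 : d ^ 2 + p ^ 2 = a ^ 2 := by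
      rcases mul_eq_zero.1 e3 with h | h
      · linarith
      · nlinarith [sq_nonneg d, sq_nonneg p]
    rw [e4] at q4 q2
    have e5 : B = 0 := by
      have : 2 * a * p * B = 0 := by linarith
      simpa [ha, hp] using this
    rw [e5] at e1
    have : A = 0 := by simpa [hp] using e1
    rw [this] at q0
    norm_num at q0
  subst hp
  have hB : B = 0 := by simpa [ha] using e1
  subst hB
  have e6 : (d ^ 2 - a ^ 2) ^ 2 = 0 := by
    linear_combination (d ^ 2) ^ 2 / 9 * q0 + a ^ 4 / 9 * q4 - a ^ 2 * d ^ 2 / 9 * q2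
  have e7 : d ^ 2 = a ^ 2 := by
    have := pow_eq_zero_iff (two_ne_zero) |>.1 e6
    linarith
  rw [e7] at q4
  exact ⟨rfl, e7, by linarith, rfl, by linarith⟩

open ComplexConjugate in
lemma rank_two_solve {κ ρ t0 t1 h0 h1 k0 k1 s0 s1 m0 m1 : ℝ} (hκ : κ ≠ 0) (hρ : ρ ≠ 0)
    (a0 : s0 ^ 2 + m0 ^ 2 = t0 ^ 2 / 4 + ρ) (a1 : s1 ^ 2 + m1 ^ 2 = t1 ^ 2 / 4 + ρ)
    (a2 : s0 * s1 + m0 * m1 = t0 * t1 / 4)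
    (b0 : h0 ^ 2 + k0 ^ 2 + t0 ^ 2 = 10 - κ - ρ) (b1 : h1 ^ 2 + k1 ^ 2 + t1 ^ 2 = 10 - κ - ρ)
    (b2 : h0 * h1 + k0 * k1 + t0 * t1 = 0)
    (hc : ∀ x y : ℝ, (s0 * x + s1 * y) * ((h0 * x + h1 * y) ^ 2 - (k0 * x + k1 * y) ^ 2)
      + 2 * (m0 * x + m1 * y) * (h0 * x + h1 * y) * (k0 * x + k1 * y) =
      -(κ - ρ) * (x ^ 2 + y ^ 2) * (t0 * x + t1 * y)
      - (t0 * x + t1 * y) / 2 * ((10 - κ - ρ) * (x ^ 2 + y ^ 2) - (t0 * x + t1 * y) ^ 2)) :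
    t0 = 0 ∧ t1 = 0 ∧ h0 = 0 ∧ h1 = 0 ∧ k0 = 0 ∧ k1 = 0 := by
  obtain ⟨c0, c1, c2, c3, -⟩ := coeff_eq_zero_of_forall (c4 := 0) fun y =>
    (by linear_combination hc 1 y :
      (s0 * (h0 ^ 2 - k0 ^ 2) + 2 * m0 * h0 * k0 + (κ - ρ) * t0
        + t0 / 2 * ((10 - κ - ρ) - t0 ^ 2))
      + (s1 * (h0 ^ 2 - k0 ^ 2) + 2 * s0 * (h0 * h1 - k0 * k1) + 2 * m1 * h0 * k0
        + 2 * m0 * (h0 * k1 + h1 * k0) + (κ - ρ) * t1 + t1 / 2 * (10 - κ - ρ)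
        - 3 / 2 * t0 ^ 2 * t1) * y
      + (s0 * (h1 ^ 2 - k1 ^ 2) + 2 * s1 * (h0 * h1 - k0 * k1) + 2 * m0 * h1 * k1
        + 2 * m1 * (h0 * k1 + h1 * k0) + (κ - ρ) * t0 + t0 / 2 * (10 - κ - ρ)
        - 3 / 2 * t0 * t1 ^ 2) * y ^ 2
      + (s1 * (h1 ^ 2 - k1 ^ 2) + 2 * m1 * h1 * k1 + (κ - ρ) * t1
        + t1 / 2 * ((10 - κ - ρ) - t1 ^ 2)) * y ^ 3 + 0 * y ^ 4 = 0)
  have key := rank_two_fourier (τ := ⟨t0 / 2, -t1 / 2⟩) (α := ⟨(h0 + k1) / 2, (k0 - h1) / 2⟩)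
    (β := ⟨(h0 - k1) / 2, -(k0 + h1) / 2⟩) (γ := ⟨(s0 - m1) / 2, -(m0 + s1) / 2⟩)
    (η := ⟨(s0 + m1) / 2, (m0 - s1) / 2⟩) (M := ((10 - κ - ρ : ℝ) : ℂ)) (κ := κ) (ρ := ρ)
    ?_ ?_ ?_ ?_ ?_ ?_ (by exact_mod_cast hκ) (by exact_mod_cast hρ)
  · obtain ⟨e1, e2, e3⟩ := key
    simp [Complex.ext_iff] at e1 e2 e3
    refine ⟨e1.1, e1.2, ?_, ?_, ?_, ?_⟩ <;> linarith
  all_goals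
    apply Complex.ext <;> simp [pow_succ]
  · linear_combination (b0 - b1) / 4
  · linear_combination -b2 / 2
  · linear_combination (b0 + b1) / 2
  · ring
  · linear_combination (a0 - a1) / 4
  · linear_combination -a2 / 2
  · linear_combination (a0 + a1) / 2
  · ring
  · linear_combination (c0 - c2) / 4
  · linear_combination (c3 - c1) / 4
  · linear_combination (3 * c0 + c2) / 4
  · linear_combination -(3 * c3 + c1) / 4

lemma CircularPair.hasNormalForm_of_rank_two {a t0 h0 k0 s0 m0 r0 d p t1 h1 k1 s1 m1 r1 : ℝ}
    (h : CircularPair !![0, 0, 0, 0, 0; 0, 0, a, 0, 0; 0, a, t0, h0, k0; 0, 0, h0, s0, m0;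
        0, 0, k0, m0, r0]
      !![0, 0, d, 0, 0; 0, 0, p, 0, 0; d, p, t1, h1, k1; 0, 0, h1, s1, m1; 0, 0, k1, m1, r1])
    (ha : a ≠ 0) : HasNormalForm !![0, 0, 0, 0, 0; 0, 0, a, 0, 0; 0, a, t0, h0, k0;
        0, 0, h0, s0, m0; 0, 0, k0, m0, r0]
      !![0, 0, d, 0, 0; 0, 0, p, 0, 0; d, p, t1, h1, k1; 0, 0, h1, s1, m1; 0, 0, k1, m1, r1] := by
  have hdet := fun x y => h.rank_two_det x y _ _ _ _ _ _ _ rfl rfl rfl rfl rfl rfl rfl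
  clear h
  obtain ⟨f0, f1, -⟩ := coeff_eq_zero_of_forall (c0 := t0 + s0 + r0) (c1 := t1 + s1 + r1)
    (c2 := 0) (c3 := 0) (c4 := 0) fun y => by linear_combination (hdet 1 y).1
  obtain ⟨u0, rfl⟩ : ∃ u0, s0 = u0 - t0 / 2 := ⟨s0 + t0 / 2, by ring⟩
  obtain ⟨u1, rfl⟩ : ∃ u1, s1 = u1 - t1 / 2 := ⟨s1 + t1 / 2, by ring⟩
  obtain rfl : r0 = -u0 - t0 / 2 := by linarith
  obtain rfl : r1 = -u1 - t1 / 2 := by linarith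
  have ha2 : a ^ 2 ≠ 0 := pow_ne_zero 2 ha
  obtain ⟨ρ, hρ⟩ : ∃ ρ, a ^ 2 * ρ = 9 := ⟨9 / a ^ 2, by field_simp⟩
  have hρ0 : ρ ≠ 0 := by rintro rfl; norm_num at hρ
  obtain ⟨rfl, hd, hA, hB, hC⟩ := binary_quadratic_factor (d := d) (p := p)
    (A := t0 ^ 2 / 4 - u0 ^ 2 - m0 ^ 2) (B := t0 * t1 / 2 - 2 * u0 * u1 - 2 * m0 * m1)
    (C := t1 ^ 2 / 4 - u1 ^ 2 - m1 ^ 2) ha fun x y => by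
      linear_combination (hdet x y).2.2.2
  have a0 : u0 ^ 2 + m0 ^ 2 = t0 ^ 2 / 4 + ρ := mul_left_cancel₀ ha2 (by linarith)
  have a1 : u1 ^ 2 + m1 ^ 2 = t1 ^ 2 / 4 + ρ := mul_left_cancel₀ ha2 (by linarith)
  have a2 : u0 * u1 + m0 * m1 = t0 * t1 / 4 := by linarith
  obtain ⟨b0, b1, b2, -⟩ := coeff_eq_zero_of_forall (c3 := 0) (c4 := 0) fun y =>
    (by linear_combination -(hdet 1 y).2.1 - y ^ 2 * hd - a0 - y ^ 2 * a1 - 2 * y * a2 :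
      (h0 ^ 2 + k0 ^ 2 + t0 ^ 2 - (10 - a ^ 2 - ρ))
      + (2 * (h0 * h1 + k0 * k1 + t0 * t1)) * y
      + (h1 ^ 2 + k1 ^ 2 + t1 ^ 2 - (10 - a ^ 2 - ρ)) * y ^ 2 + 0 * y ^ 3 + 0 * y ^ 4 = 0)
  have hc : ∀ x y : ℝ, (u0 * x + u1 * y) * ((h0 * x + h1 * y) ^ 2 - (k0 * x + k1 * y) ^ 2)
      + 2 * (m0 * x + m1 * y) * (h0 * x + h1 * y) * (k0 * x + k1 * y) =
      -(a ^ 2 - ρ) * (x ^ 2 + y ^ 2) * (t0 * x + t1 * y)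
      - (t0 * x + t1 * y) / 2 * ((10 - a ^ 2 - ρ) * (x ^ 2 + y ^ 2) - (t0 * x + t1 * y) ^ 2) := by
    intro x y
    linear_combination -(hdet x y).2.2.1 - (t0 * x + t1 * y) * y ^ 2 * hd
      + (t0 * x + t1 * y) * (x ^ 2 * a0 + y ^ 2 * a1 + 2 * x * y * a2)
      - (t0 * x + t1 * y) / 2 * (x ^ 2 * b0 + x * y * b1 + y ^ 2 * b2)
  obtain ⟨rfl, rfl, rfl, rfl, rfl, rfl⟩ := rank_two_solve ha2 hρ0 a0 a1 a2
    (by linarith) (by linarith) (by linarith) hc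
  obtain ⟨σ, rfl⟩ : ∃ σ, d = σ * a := ⟨d / a, by field_simp⟩
  have hσ : σ ^ 2 = 1 := mul_right_cancel₀ ha2 (by linarith)
  obtain ⟨ε, hε, rfl, rfl⟩ : ∃ ε : ℝ, ε ^ 2 = 1 ∧ u1 = -(ε * m0) ∧ m1 = ε * u0 := by
    refine ⟨(u0 * m1 - m0 * u1) / ρ, ?_, ?_, ?_⟩ <;> field_simp
    · linear_combination (u1 ^ 2 + m1 ^ 2) * a0 + ρ * a1 - (u0 * u1 + m0 * m1) * a2
    · linear_combination -u1 * a0 + u0 * a2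
    · linear_combination -m1 * a0 + m0 * a2
  have hκ : (a ^ 2 - 1) * (a ^ 2 - 9) = 0 := by linear_combination a ^ 2 * b0 - hρ
  rcases mul_eq_zero.1 hκ with h | h
  · have h9 : ρ = 9 := by linear_combination hρ - ρ * h
    obtain ⟨c, e, hce, hs, ht⟩ := exists_half_angle (s := u0 / 3) (t := m0 / 3)
      (by linear_combination a0 / 9 + h9 / 9)
    obtain rfl : u0 = 3 * (c ^ 2 - e ^ 2) := by linarith
    obtain rfl : m0 = 3 * (2 * c * e) := by linarith
    simpa using hasNormalForm_rank_two_model_one (by linarith) hσ hε hce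
  · have h9 : ρ = 1 := by linear_combination hρ / 9 - ρ / 9 * h
    obtain ⟨c, e, hce, rfl, rfl⟩ := exists_half_angle (s := u0) (t := m0)
      (by linear_combination a0 + h9)
    simpa using hasNormalForm_rank_two_model_three (by linarith) hσ hε hce

lemma CircularPair.hasNormalForm {B : Matrix (Fin 5) (Fin 5) ℝ} (hB : B.IsSymm)
    (h : CircularPair D5 B) : HasNormalForm D5 B := by
  have hB' := exists_eq_of_isSymm hB
  rw [hB'] at h
  obtain ⟨h0, h1, h2, h3, h4⟩ := h.diag_eq_zero
  rw [h0, h1, h2, h3, h4] at h hB'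
  clear h0 h1 h2 h3 h4
  generalize B 0 1 = a at *
  generalize B 0 2 = p0 at *
  generalize B 0 3 = b at *
  generalize B 0 4 = c at *
  generalize B 1 2 = p1 at *
  generalize B 1 3 = d at *
  generalize B 1 4 = f at *
  generalize B 2 3 = p3 at *
  generalize B 2 4 = p4 at *
  generalize B 3 4 = g at *
  by_cases hp : p0 = 0 ∧ p1 = 0 ∧ p3 = 0 ∧ p4 = 0
  · obtain ⟨rfl, rfl, rfl, rfl⟩ := hp
    rw [hB']
    obtain ⟨h1, h2, h3, h4, h5, h6, h7⟩ := h.quartic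
    exact hasNormalForm_of_quartic (quartic_cases h1 h2 h3 h4 h5 h6 h7)
  obtain ⟨w0, hw0⟩ : ∃ w0, 3 * w0 = -p0 := ⟨-p0 / 3, by ring⟩
  obtain ⟨w1, hw1⟩ : ∃ w1, w1 = -p1 := ⟨_, rfl⟩
  obtain ⟨w3, hw3⟩ : ∃ w3, -w3 = -p3 := ⟨_, rfl⟩
  obtain ⟨w4, hw4⟩ : ∃ w4, -3 * w4 = -p4 := ⟨p4 / 3, by ring⟩
  obtain ⟨u0, hu0⟩ : ∃ u0, 3 * u0 = -(a * w1 + b * w3 + c * w4) :=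
    ⟨-(a * w1 + b * w3 + c * w4) / 3, by ring⟩
  obtain ⟨u1, hu1⟩ : ∃ u1, u1 = -(a * w0 + d * w3 + f * w4) := ⟨_, rfl⟩
  obtain ⟨u3, hu3⟩ : ∃ u3, -u3 = -(b * w0 + d * w1 + g * w4) := ⟨_, rfl⟩
  obtain ⟨u4, hu4⟩ : ∃ u4, -3 * u4 = -(c * w0 + f * w1 + g * w3) :=
    ⟨(c * w0 + f * w1 + g * w3) / 3, by ring⟩
  obtain ⟨i1, i2, i3, i4⟩ := h.isotropic hw0 hw1 hw3 hw4 hu0 hu1 hu3 hu4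
  have hD : D5.IsSymm := by
    ext i j
    fin_cases i <;> fin_cases j <;> rfl
  have hDe : D5 *ᵥ ![0, 0, 1, 0, 0] = 0 := by
    ext i
    fin_cases i <;> simp [D5, Matrix.mulVec, dotProduct, Fin.sum_univ_succ]
  have he : (![0, 0, 1, 0, 0] : Fin 5 → ℝ) ≠ 0 := fun h => by simpa using congrFun h 2
  have eDw : D5 *ᵥ ![w0, w1, 0, w3, w4] = ![-p0, -p1, 0, -p3, -p4] := by
    ext i
    fin_cases i <;> simp [D5, Matrix.mulVec, dotProduct, Fin.sum_univ_succ] <;> linarith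
  have hDw : D5 *ᵥ ![w0, w1, 0, w3, w4] ≠ 0 := by
    rw [eDw]
    intro h
    apply hp
    simpa using And.intro (congrFun h 0) (And.intro (congrFun h 1)
      (And.intro (congrFun h 3) (congrFun h 4)))
  have hBe : B *ᵥ ![0, 0, 1, 0, 0] = -(D5 *ᵥ ![w0, w1, 0, w3, w4]) := by
    rw [eDw, hB']
    ext i
    fin_cases i <;> simp [Matrix.mulVec, dotProduct, Fin.sum_univ_succ]
  have eDu : D5 *ᵥ ![u0, u1, 0, u3, u4] = ![3 * u0, u1, 0, -u3, -3 * u4] := by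
    ext i
    fin_cases i <;> simp [D5, Matrix.mulVec, dotProduct, Fin.sum_univ_succ]
  have hBw : B *ᵥ ![w0, w1, 0, w3, w4] = -(D5 *ᵥ ![u0, u1, 0, u3, u4]) := by
    rw [eDu, hB', hu0, hu1, hu3, hu4]
    ext i
    fin_cases i <;> simp [Matrix.mulVec, dotProduct, Fin.sum_univ_succ] <;>
      first | ring1 | linear_combination -i1 + w0 * hw0 + w1 * hw1 + w3 * hw3 + w4 * hw4
  have hww : ![w0, w1, 0, w3, w4] ⬝ᵥ (D5 *ᵥ ![w0, w1, 0, w3, w4]) = 0 := by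
    rw [eDw]
    simp [dotProduct, Fin.sum_univ_succ]
    linear_combination i1 - w0 * hw0 - w1 * hw1 - w3 * hw3 - w4 * hw4
  have hB2 := h
  rw [← hB'] at hB2
  by_cases hμ : ∃ μ : ℝ, D5 *ᵥ ![u0, u1, 0, u3, u4] = μ • (D5 *ᵥ ![w0, w1, 0, w3, w4])
  · obtain ⟨μ, hμ⟩ := hμ
    rw [hμ] at hBw
    obtain ⟨O, hO, a, t0, h0, k0, s0, m0, r0, d, p, t1, h1, k1, s1, m1, r1, ha, e0, e1⟩ :=
      exists_conj_rank_two hD hB hDe hBe hBw hww he hDw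
    have := hB2.conj hO
    apply HasNormalForm.of_conj hO
    rw [e0, e1] at this ⊢
    exact this.hasNormalForm_of_rank_two ha
  · push Not at hμ
    have hwBw : ![w0, w1, 0, w3, w4] ⬝ᵥ (B *ᵥ ![w0, w1, 0, w3, w4]) = 0 := by
      rw [hB']
      simp [Matrix.mulVec, dotProduct, Fin.sum_univ_succ]
      linear_combination 2 * i2
    have huBu : ![u0, u1, 0, u3, u4] ⬝ᵥ (B *ᵥ ![u0, u1, 0, u3, u4]) = 0 := by
      rw [hB']
      simp [Matrix.mulVec, dotProduct, Fin.sum_univ_succ]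
      linear_combination 2 * i4
    have huu : ![u0, u1, 0, u3, u4] ⬝ᵥ (D5 *ᵥ ![u0, u1, 0, u3, u4]) = 0 := by
      rw [eDu]
      simp [dotProduct, Fin.sum_univ_succ]
      linear_combination i3
    obtain ⟨O, hO, a, b, c, s0, m0, r0, d, p, q, m, n, s1, m1, r1, hd, e0, e1⟩ :=
      exists_conj_rank_three hD hB hDe hBe hBw hww hwBw huu huBu he hDw hμ
    have := hB2.conj hO
    apply HasNormalForm.of_conj hO
    rw [e0, e1] at this ⊢
    exact this.hasNormalForm_of_rank_three hd

/-- main theorem: if `L(t) = cos(t)·L0 + sin(t)·L1` is isospectral with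
`L0 = diag(√3, 1/√3, 0, -1/√3, -√3)`, then up to conjugation by a real orthogonal matrix
`A` with `A·L0·A⁻¹ = L0`, the matrix `L1` is one of the six matrices `M₁, …, M₆`. -/
theorem statement16 (L1 : Matrix (Fin 5) (Fin 5) ℝ) (hsymm : L1.IsSymm)
    (hiso : Isospectral L1) :
    ∃ A : Matrix (Fin 5) (Fin 5) ℝ, A * Aᵀ = 1 ∧ A * L0d * A⁻¹ = L0d ∧
      (A * L1 * A⁻¹ = M₁ ∨ A * L1 * A⁻¹ = M₂ ∨ A * L1 * A⁻¹ = M₃ ∨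
       A * L1 * A⁻¹ = M₄ ∨ A * L1 * A⁻¹ = M₅ ∨ A * L1 * A⁻¹ = M₆) := by
  exact (hiso.circularPair.hasNormalForm (hsymm.smul _)).exists_conj

end
end

section
/- Let L1 := (1/√6)·[[0,0,0,0,3√2],[0,0,1,0,0],[0,1,0,1,0],[0,0,1,0,0],[3√2,0,0,0,0]] and L(t) := cos(t)·L0 + sin(t)·L1. Then for every t ∈ ℝ the vectors e₁(t) := (cos(t/2), 0, 0, 0, sin(t/2)), e₂(t) := (0, cos²(t/2), sin(t)/√2, sin²(t/2), 0), e₃(t) := (0, −sin(t)/√2, cos(t), sin(t)/√2, 0), e₄(t) := (0, sin²(t/2), −sin(t)/√2, cos²(t/2), 0), e₅(t) := (−sin(t/2), 0, 0, 0, cos(t/2)) form an orthonormal basis of ℝ^5 consisting of eigenvectors of L(t) with eigenvalues √3, 1/√3, 0, −1/√3, −√3, respectively; moreover e₃(π) = −e₃(0), e₂(π) = e₄(0), e₄(π) = e₂(0), e₁(π) = e₅(0) and e₅(π) = −e₁(0). -/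
open Matrix Kronecker

noncomputable section

/-- The five curves of eigenvectors `e₁(t), …, e₅(t)`. -/
def evecs : Fin 5 → ℝ → Fin 5 → ℝ :=
  ![fun t => ![Real.cos (t / 2), 0, 0, 0, Real.sin (t / 2)],
    fun t => ![0, Real.cos (t / 2) ^ 2, Real.sin t / Real.sqrt 2, Real.sin (t / 2) ^ 2, 0],
    fun t => ![0, -(Real.sin t / Real.sqrt 2), Real.cos t, Real.sin t / Real.sqrt 2, 0],
    fun t => ![0, Real.sin (t / 2) ^ 2, -(Real.sin t / Real.sqrt 2), Real.cos (t / 2) ^ 2, 0],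
    fun t => ![-Real.sin (t / 2), 0, 0, 0, Real.cos (t / 2)]]

/-- The corresponding eigenvalues `√3, 1/√3, 0, -1/√3, -√3`. -/
def evals : Fin 5 → ℝ :=
  ![Real.sqrt 3, 1 / Real.sqrt 3, 0, -(1 / Real.sqrt 3), -Real.sqrt 3]

theorem inv_sqrt_two : (√(2 : ℝ))⁻¹ = √2 / 2 := by
  have h : √(2 : ℝ) ^ 2 = 2 := Real.sq_sqrt (by norm_num)
  field_simp
  rw [h]

theorem inv_sqrt_three : (√(3 : ℝ))⁻¹ = √3 / 3 := by
  have h : √(3 : ℝ) ^ 2 = 3 := Real.sq_sqrt (by norm_num)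
  field_simp
  rw [h]

theorem inv_sqrt_six : (√(6 : ℝ))⁻¹ = √2 * √3 / 6 := by
  have h : √(6 : ℝ) = √2 * √3 := by
    rw [← Real.sqrt_mul (by norm_num)]
    norm_num
  rw [h, mul_inv, inv_sqrt_two, inv_sqrt_three]
  ring

/-- The eigenvectors written as polynomials in the sine and cosine of the half angle. -/
theorem evecs_half_angle (t : ℝ) (i : Fin 5) :
    evecs i t =
      !![Real.cos (t / 2), 0, 0, 0, Real.sin (t / 2);
         0, Real.cos (t / 2) ^ 2, √2 * Real.sin (t / 2) * Real.cos (t / 2),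
           Real.sin (t / 2) ^ 2, 0;
         0, -(√2 * Real.sin (t / 2) * Real.cos (t / 2)),
           Real.cos (t / 2) ^ 2 - Real.sin (t / 2) ^ 2,
           √2 * Real.sin (t / 2) * Real.cos (t / 2), 0;
         0, Real.sin (t / 2) ^ 2, -(√2 * Real.sin (t / 2) * Real.cos (t / 2)),
           Real.cos (t / 2) ^ 2, 0;
         -Real.sin (t / 2), 0, 0, 0, Real.cos (t / 2)] i := by
  have hs : Real.sin t / √2 = √2 * Real.sin (t / 2) * Real.cos (t / 2) := by
    rw [div_eq_mul_inv, inv_sqrt_two]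
    nth_rewrite 1 [← mul_div_cancel₀ t (two_ne_zero' ℝ)]
    rw [Real.sin_two_mul]
    ring
  have hc : Real.cos t = Real.cos (t / 2) ^ 2 - Real.sin (t / 2) ^ 2 := by
    rw [← Real.cos_two_mul', mul_div_cancel₀ t two_ne_zero]
  fin_cases i <;> simp [evecs, hs, hc] <;> rfl

/-- for `L1 = M₂` and `L(t) = cos(t)·L0 + sin(t)·L1`, the vectors
`e₁(t), …, e₅(t)` form an orthonormal basis of `ℝ⁵` consisting of eigenvectors of `L(t)`
with eigenvalues `√3, 1/√3, 0, -1/√3, -√3`, respectively; moreover `e₃(π) = -e₃(0)`,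
`e₂(π) = e₄(0)`, `e₄(π) = e₂(0)`, `e₁(π) = e₅(0)` and `e₅(π) = -e₁(0)`. -/
theorem statement19 :
    (∀ t : ℝ, ∀ i j : Fin 5,
      evecs i t ⬝ᵥ evecs j t = if i = j then 1 else 0) ∧
    (∀ t : ℝ, ∀ i : Fin 5,
      (Real.cos t • L0d + Real.sin t • M₂).mulVec (evecs i t) = evals i • evecs i t) ∧
    evecs 2 Real.pi = -(evecs 2 0) ∧
    evecs 1 Real.pi = evecs 3 0 ∧
    evecs 3 Real.pi = evecs 1 0 ∧
    evecs 0 Real.pi = evecs 4 0 ∧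
    evecs 4 Real.pi = -(evecs 0 0) := by
  refine ⟨fun t i j => ?_, fun t i => ?_, ?_, ?_, ?_, ?_, ?_⟩
  · have h2 : √(2 : ℝ) ^ 2 = 2 := Real.sq_sqrt (by norm_num)
    have hu := Real.sin_sq_add_cos_sq (t / 2)
    simp only [evecs_half_angle]
    generalize Real.sin (t / 2) = s, Real.cos (t / 2) = c, √(2 : ℝ) = a at *
    fin_cases i <;> fin_cases j <;> simp [dotProduct, Fin.sum_univ_succ] <;> grind
  · have h2 : √(2 : ℝ) ^ 2 = 2 := Real.sq_sqrt (by norm_num)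
    have h3 : √(3 : ℝ) ^ 2 = 3 := Real.sq_sqrt (by norm_num)
    have hu := Real.sin_sq_add_cos_sq (t / 2)
    have hs : Real.sin t = 2 * Real.sin (t / 2) * Real.cos (t / 2) := by
      rw [← Real.sin_two_mul, mul_div_cancel₀ t two_ne_zero]
    have hc : Real.cos t = Real.cos (t / 2) ^ 2 - Real.sin (t / 2) ^ 2 := by
      rw [← Real.cos_two_mul', mul_div_cancel₀ t two_ne_zero]
    simp only [evecs_half_angle, evals, L0d, M₂, one_div, inv_sqrt_three, inv_sqrt_six, hs, hc]
    clear hs hc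
    generalize Real.sin (t / 2) = s, Real.cos (t / 2) = c, √(2 : ℝ) = a, √(3 : ℝ) = b at *
    ext k
    fin_cases i <;> fin_cases k <;>
      simp [mulVec, dotProduct, Fin.sum_univ_succ, Matrix.diagonal] <;> grind
  all_goals
    ext k
    fin_cases k <;> simp [evecs]

end
end
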